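/- arXiv:1002.1089 — 16 statements merged into one kernel-verified Lean document; each statement's English description precedes it below -/
import Mathlib

section
/- Let K be a field and k ≥ 2. If A : ℤ × ℤ → K is an SL_k-tiling all of whose adjacent (k−1)×(k−1) minors are nonzero (a 0-free SL_k-tiling), then A is tame; that is, the K-linear span of the rows of A has dimension exactly k. -/
/-- The adjacent `m × m` minor of a tiling `A : ℤ × ℤ → K` at position `(i, j)`:
the determinant of the matrix `(A (i+s, j+t))_{0 ≤ s,t < m}`. -/
noncomputable def adjMinor {K : Type*} [Field K] (A : ℤ × ℤ → K) (m : ℕ) (i j : ℤ) : K :=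
  (Matrix.of fun s t : Fin m => A (i + ((s : ℕ) : ℤ), j + ((t : ℕ) : ℤ))).det

/-- `A` is an `SL_k`-tiling: all adjacent `k × k` minors equal `1`. -/
def IsSL {K : Type*} [Field K] (k : ℕ) (A : ℤ × ℤ → K) : Prop :=
  ∀ i j : ℤ, adjMinor A k i j = 1

/-- The rank of a tiling: the dimension of the `K`-linear span of its rows. -/
noncomputable def tilingRank (K : Type*) [Field K] (A : ℤ × ℤ → K) : Cardinal :=
  Module.rank K (Submodule.span K (Set.range fun i : ℤ => fun j : ℤ => A (i, j)))

/-- The `i`-th row of a tiling. -/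
def tilingRow {K : Type*} (A : ℤ × ℤ → K) (i : ℤ) : ℤ → K := fun j => A (i, j)

/-- The square matrix formed by the adjacent entries of `A` starting at `(i, j)`. -/
def adjBlock {K : Type*} (A : ℤ × ℤ → K) (m : ℕ) (i j : ℤ) : Matrix (Fin m) (Fin m) K :=
  Matrix.of fun s t => A (i + ((s : ℕ) : ℤ), j + ((t : ℕ) : ℤ))

section

variable {K : Type*} [Field K] {n : ℕ} {A : ℤ × ℤ → K}

theorem det_adjBlock (m : ℕ) (i j : ℤ) : (adjBlock A m i j).det = adjMinor A m i j := rfl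

theorem IsSL.isUnit_adjBlock {k : ℕ} (hSL : IsSL k A) (i j : ℤ) : IsUnit (adjBlock A k i j) := by
  rw [Matrix.isUnit_iff_isUnit_det, det_adjBlock, hSL i j]
  exact isUnit_one

/-- Any `k` consecutive rows of an `SL_k`-tiling are linearly independent. -/
theorem IsSL.linearIndependent_rows {k : ℕ} (hSL : IsSL k A) (i : ℤ) :
    LinearIndependent K fun s : Fin k => tilingRow A (i + ((s : ℕ) : ℤ)) := by
  have h := Matrix.linearIndependent_rows_iff_isUnit.mpr (hSL.isUnit_adjBlock i 0)
  exact LinearIndependent.of_comp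
    (LinearMap.funLeft K K fun t : Fin k => (0 : ℤ) + ((t : ℕ) : ℤ)) h

/-- On a window of `n + 1` columns, each row is a combination of the `n + 1` preceding ones. -/
theorem IsSL.exists_local_recurrence (hSL : IsSL (n + 1) A) (i j : ℤ) :
    ∃ x : Fin (n + 1) → K, ∀ t : Fin (n + 1),
      ∑ s : Fin (n + 1), x s * A (i + ((s : ℕ) : ℤ), j + ((t : ℕ) : ℤ)) =
        A (i + (n + 1 : ℕ), j + ((t : ℕ) : ℤ)) := by
  obtain ⟨x, hx⟩ := Matrix.vecMul_surjective_iff_isUnit.mpr (hSL.isUnit_adjBlock i j)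
    fun t => A (i + (n + 1 : ℕ), j + ((t : ℕ) : ℤ))
  exact ⟨x, fun t => congrFun hx t⟩

/-- The leading coefficient of a local recurrence is the sign of a cyclic permutation. -/
theorem IsSL.local_recurrence_zero (hSL : IsSL (n + 1) A) (i j : ℤ) (x : Fin (n + 1) → K)
    (hx : ∀ t : Fin (n + 1),
      ∑ s : Fin (n + 1), x s * A (i + ((s : ℕ) : ℤ), j + ((t : ℕ) : ℤ)) =
        A (i + (n + 1 : ℕ), j + ((t : ℕ) : ℤ))) :
    ((Equiv.Perm.sign (finRotate (n + 1)) : ℤ) : K) * x 0 = 1 := by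
  have h1 := Matrix.det_updateRow_sum (adjBlock A (n + 1) i j) 0 x
  rw [det_adjBlock, hSL i j, smul_eq_mul, mul_one] at h1
  rw [← h1, ← Matrix.det_permute, ← hSL (i + 1) j, ← det_adjBlock]
  congr 1
  ext s t
  refine Fin.lastCases ?_ (fun s => ?_) s
  · have := hx t
    simp only [Matrix.submatrix_apply, finRotate_last, Matrix.updateRow_self, id]
    simp only [adjBlock, Matrix.of_apply, Finset.sum_apply, Pi.smul_apply, smul_eq_mul, this,
      Fin.val_last]
    congr 2
    push_cast
    ring
  · have h : finRotate (n + 1) s.castSucc = s.succ := by simp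
    simp only [Matrix.submatrix_apply, h, id, Matrix.updateRow_ne (Fin.succ_ne_zero s)]
    simp only [adjBlock, Matrix.of_apply, Fin.val_succ, Fin.val_castSucc]
    congr 2
    push_cast
    ring

/-- In a `0`-free tiling, local recurrences on two neighbouring windows coincide. -/
theorem IsSL.local_recurrence_unique (hSL : IsSL (n + 1) A) (h0 : ∀ i j : ℤ, adjMinor A n i j ≠ 0)
    (i j : ℤ) (x y : Fin (n + 1) → K)
    (hx : ∀ t : Fin (n + 1),
      ∑ s : Fin (n + 1), x s * A (i + ((s : ℕ) : ℤ), j + ((t : ℕ) : ℤ)) =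
        A (i + (n + 1 : ℕ), j + ((t : ℕ) : ℤ)))
    (hy : ∀ t : Fin (n + 1),
      ∑ s : Fin (n + 1), y s * A (i + ((s : ℕ) : ℤ), j + 1 + ((t : ℕ) : ℤ)) =
        A (i + (n + 1 : ℕ), j + 1 + ((t : ℕ) : ℤ))) :
    x = y := by
  have hzero : x 0 = y 0 := by
    have h1 := hSL.local_recurrence_zero i j x hx
    have h2 := hSL.local_recurrence_zero i (j + 1) y hy
    exact mul_left_cancel₀ (left_ne_zero_of_mul_eq_one h1) (h1.trans h2.symm)
  have htail : (fun s : Fin n => x s.succ - y s.succ) = 0 := by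
    refine Matrix.eq_zero_of_vecMul_eq_zero (M := adjBlock A n (i + 1) (j + 1)) (h0 _ _) ?_
    ext t
    have e1 := hx t.succ
    have e2 := hy t.castSucc
    have hc : j + ((t.succ : ℕ) : ℤ) = j + 1 + ((t.castSucc : ℕ) : ℤ) := by
      simp only [Fin.val_succ, Fin.val_castSucc]
      push_cast
      ring
    rw [hc, ← e2, Fin.sum_univ_succ, Fin.sum_univ_succ, hzero, add_right_inj, ← sub_eq_zero,
      ← Finset.sum_sub_distrib] at e1
    rw [Pi.zero_apply, ← e1, Matrix.vecMul, dotProduct]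
    refine Finset.sum_congr rfl fun s _ => ?_
    have hr : i + ((s.succ : ℕ) : ℤ) = i + 1 + ((s : ℕ) : ℤ) := by
      simp only [Fin.val_succ]
      push_cast
      ring
    rw [hr, ← sub_mul]
    rfl
  ext s
  refine Fin.cases hzero (fun s => ?_) s
  exact sub_eq_zero.mp (congrFun htail s)

/-- In a `0`-free `SL_{n+1}`-tiling each row is a combination of the `n + 1` preceding ones. -/
theorem IsSL.exists_recurrence (hSL : IsSL (n + 1) A) (h0 : ∀ i j : ℤ, adjMinor A n i j ≠ 0)
    (i : ℤ) :
    ∃ x : Fin (n + 1) → K,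
      ∑ s : Fin (n + 1), x s • tilingRow A (i + ((s : ℕ) : ℤ)) = tilingRow A (i + (n + 1 : ℕ)) := by
  choose x hx using hSL.exists_local_recurrence i
  have hstep (j : ℤ) : x j = x (j + 1) :=
    hSL.local_recurrence_unique h0 i j _ _ (hx j) (hx (j + 1))
  have hconst (j : ℤ) : x j = x 0 := by
    induction j using Int.induction_on with
    | zero => rfl
    | succ j ih => rw [← hstep, ih]
    | pred j ih => rw [hstep, sub_add_cancel, ih]
  refine ⟨x 0, ?_⟩
  ext j
  have h := hx j 0
  rw [hconst j] at h
  simpa [tilingRow] using h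

/-- In a `0`-free tiling, the span of `n + 1` consecutive rows does not depend on their position. -/
theorem IsSL.span_rows_succ (hSL : IsSL (n + 1) A) (h0 : ∀ i j : ℤ, adjMinor A n i j ≠ 0)
    (i : ℤ) :
    Submodule.span K (Set.range fun s : Fin (n + 1) => tilingRow A (i + 1 + ((s : ℕ) : ℤ))) =
      Submodule.span K (Set.range fun s : Fin (n + 1) => tilingRow A (i + ((s : ℕ) : ℤ))) := by
  have := FiniteDimensional.span_of_finite K
    (Set.finite_range fun s : Fin (n + 1) => tilingRow A (i + ((s : ℕ) : ℤ)))
  refine Submodule.eq_of_le_of_finrank_eq ?_ ?_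
  · rw [Submodule.span_le]
    rintro _ ⟨s, rfl⟩
    refine Fin.lastCases ?_ (fun s => ?_) s
    · obtain ⟨x, hx⟩ := hSL.exists_recurrence h0 i
      have hr : i + 1 + ((Fin.last n : ℕ) : ℤ) = i + (n + 1 : ℕ) := by
        simp only [Fin.val_last]
        push_cast
        ring
      simp only [hr, ← hx]
      exact Submodule.sum_mem _ fun s _ =>
        Submodule.smul_mem _ _ (Submodule.subset_span ⟨s, rfl⟩)
    · refine Submodule.subset_span ⟨s.succ, ?_⟩
      simp only [Fin.val_succ, Fin.val_castSucc]
      congr 1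
      push_cast
      ring
  · rw [finrank_span_eq_card (hSL.linearIndependent_rows (i + 1)),
      finrank_span_eq_card (hSL.linearIndependent_rows i)]

theorem IsSL.span_range_tilingRow (hSL : IsSL (n + 1) A) (h0 : ∀ i j : ℤ, adjMinor A n i j ≠ 0) :
    Submodule.span K (Set.range (tilingRow A)) =
      Submodule.span K (Set.range fun s : Fin (n + 1) => tilingRow A (0 + ((s : ℕ) : ℤ))) := by
  have hstep := hSL.span_rows_succ h0
  have hconst (i : ℤ) :
      Submodule.span K (Set.range fun s : Fin (n + 1) => tilingRow A (i + ((s : ℕ) : ℤ))) =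
        Submodule.span K (Set.range fun s : Fin (n + 1) => tilingRow A (0 + ((s : ℕ) : ℤ))) := by
    induction i using Int.induction_on with
    | zero => rfl
    | succ i ih => rw [hstep, ih]
    | pred i ih => rw [← hstep, sub_add_cancel, ih]
  apply le_antisymm
  · rw [Submodule.span_le]
    rintro _ ⟨i, rfl⟩
    rw [← hconst i]
    exact Submodule.subset_span ⟨0, by simp⟩
  · refine Submodule.span_mono ?_
    rintro _ ⟨s, rfl⟩
    exact ⟨_, rfl⟩

end

/-- A `0`-free `SL_k`-tiling (all adjacent `(k-1) × (k-1)` minors nonzero) is tame: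
its rank is exactly `k`. -/
theorem zeroFree_SLk_tiling_is_tame {K : Type*} [Field K] (k : ℕ) (hk : 2 ≤ k)
    (A : ℤ × ℤ → K) (hSL : IsSL k A)
    (h0 : ∀ i j : ℤ, adjMinor A (k - 1) i j ≠ 0) :
    tilingRank K A = k := by
  obtain ⟨n, rfl⟩ : ∃ n, k = n + 1 := ⟨k - 1, by omega⟩
  rw [Nat.add_sub_cancel] at h0
  change Module.rank K (Submodule.span K (Set.range (tilingRow A))) = _
  have := FiniteDimensional.span_of_finite K
    (Set.finite_range fun s : Fin (n + 1) => tilingRow A (0 + ((s : ℕ) : ℤ)))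
  rw [hSL.span_range_tilingRow h0, ← Module.finrank_eq_rank,
    finrank_span_eq_card (hSL.linearIndependent_rows 0), Fintype.card_fin]
end

section
/- Let K be a field, k ≥ 1, and A : ℤ × ℤ → K. If every adjacent (k+1)×(k+1) minor of A vanishes while no adjacent k×k minor of A vanishes, then A has rank exactly k, i.e. the K-linear span of the rows of A has dimension k. -/
section AdjMinor

variable {K : Type*} [Field K] {A : ℤ × ℤ → K} {k : ℕ}

/-- The rows of a nonsingular adjacent block satisfy no nontrivial linear relation. -/
lemma eq_zero_of_adjMinor_ne_zero {i j : ℤ} (h : adjMinor A k i j ≠ 0) {v : Fin k → K}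
    (hv : ∀ t : Fin k, ∑ s : Fin k, v s * A (i + ((s : ℕ) : ℤ), j + ((t : ℕ) : ℤ)) = 0) :
    v = 0 :=
  Matrix.eq_zero_of_vecMul_eq_zero h <| funext fun t => by
    simpa [Matrix.vecMul, dotProduct] using hv t

/-- A singular adjacent block of size `k + 1` whose upper left block of size `k` is nonsingular
has a row relation with last coefficient `1`. -/
lemma exists_relation_of_adjMinor_eq_zero {i j : ℤ} (h : adjMinor A (k + 1) i j = 0)
    (h' : adjMinor A k i j ≠ 0) :
    ∃ c : Fin (k + 1) → K, c (Fin.last k) = 1 ∧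
      ∀ t : Fin (k + 1),
        ∑ s : Fin (k + 1), c s * A (i + ((s : ℕ) : ℤ), j + ((t : ℕ) : ℤ)) = 0 := by
  obtain ⟨v, hv0, hv⟩ := Matrix.exists_vecMul_eq_zero_iff.mpr h
  have hv (t : Fin (k + 1)) :
      ∑ s : Fin (k + 1), v s * A (i + ((s : ℕ) : ℤ), j + ((t : ℕ) : ℤ)) = 0 := by
    simpa [Matrix.vecMul, dotProduct] using congrFun hv t
  have hlast : v (Fin.last k) ≠ 0 := by
    intro hl
    have hz : (fun s : Fin k => v s.castSucc) = 0 :=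
      eq_zero_of_adjMinor_ne_zero h' fun t => by
        simpa [Fin.sum_univ_castSucc, hl] using hv t.castSucc
    exact hv0 (funext fun s => Fin.lastCases hl (fun s => congrFun hz s) s)
  refine ⟨fun s => (v (Fin.last k))⁻¹ * v s, inv_mul_cancel₀ hlast, fun t => ?_⟩
  simp only [mul_assoc, ← Finset.mul_sum, hv t, mul_zero]

/-- Any `k + 1` consecutive rows satisfy a linear relation with nonzero extreme coefficients. -/
lemma exists_row_relation (hvanish : ∀ i j : ℤ, adjMinor A (k + 1) i j = 0)
    (hnonzero : ∀ i j : ℤ, adjMinor A k i j ≠ 0) (i : ℤ) :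
    ∃ c : Fin (k + 1) → K, c 0 ≠ 0 ∧ c (Fin.last k) ≠ 0 ∧
      ∀ j : ℤ, ∑ s : Fin (k + 1), c s * A (i + ((s : ℕ) : ℤ), j) = 0 := by
  choose c hc1 hc using fun j =>
    exists_relation_of_adjMinor_eq_zero (hvanish i j) (hnonzero i j)
  have hstep (j : ℤ) : c (j + 1) = c j := by
    have hz : (fun s : Fin k => c (j + 1) s.castSucc - c j s.castSucc) = 0 := by
      refine eq_zero_of_adjMinor_ne_zero (hnonzero i (j + 1)) fun t => ?_
      have h₁ := hc (j + 1) t.castSucc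
      have h₂ := hc j t.succ
      have e : j + (((t.succ : Fin (k + 1)) : ℕ) : ℤ) = j + 1 + ((t : ℕ) : ℤ) := by
        push_cast [Fin.val_succ]; ring
      rw [e] at h₂
      simp only [Fin.sum_univ_castSucc, hc1, Fin.val_castSucc] at h₁ h₂
      simp only [sub_mul, Finset.sum_sub_distrib]
      linear_combination h₁ - h₂
    funext s
    refine Fin.lastCases ?_ (fun s => sub_eq_zero.mp (congrFun hz s)) s
    rw [hc1, hc1]
  have hconst (j : ℤ) : c j = c 0 := by
    induction j using Int.induction_on with
    | zero => rfl
    | succ n ih => rw [hstep, ih]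
    | pred n ih => rw [← ih, ← hstep, sub_add_cancel]
  have hrel (j : ℤ) : ∑ s : Fin (k + 1), c 0 s * A (i + ((s : ℕ) : ℤ), j) = 0 := by
    simpa [hconst j] using hc j 0
  refine ⟨c 0, fun h0 => ?_, by simp [hc1], hrel⟩
  have hz : (fun s : Fin k => c 0 s.succ) = 0 := by
    refine eq_zero_of_adjMinor_ne_zero (hnonzero (i + 1) 0) fun t => ?_
    simpa [Fin.sum_univ_succ, h0, add_assoc, add_comm (1 : ℤ)] using hrel (0 + ((t : ℕ) : ℤ))
  have hall : c 0 = 0 := funext fun s => Fin.cases h0 (fun s => congrFun hz s) s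
  simpa [hall] using hc1 0

end AdjMinor

/-- In a vanishing linear combination, a vector with nonzero coefficient lies in every subspace
containing all the others. -/
lemma Submodule.mem_of_sum_smul_eq_zero {K V ι : Type*} [Field K] [AddCommGroup V] [Module K V]
    [Fintype ι] [DecidableEq ι] (S : Submodule K V) {c : ι → K} {v : ι → V}
    (h : ∑ s, c s • v s = 0) {a : ι} (ha : c a ≠ 0) (hv : ∀ s, s ≠ a → v s ∈ S) : v a ∈ S := by
  rw [← Finset.add_sum_erase _ _ (Finset.mem_univ a)] at h
  rw [← S.smul_mem_iff ha, eq_neg_of_add_eq_zero_left h]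
  exact S.neg_mem <| S.sum_mem fun s hs => S.smul_mem _ (hv s (Finset.ne_of_mem_erase hs))

/-- If all adjacent `(k+1) × (k+1)` minors of `A` vanish while no adjacent `k × k` minor
vanishes, then `A` has rank exactly `k`. -/
theorem rank_eq_of_adjMinors {K : Type*} [Field K] (k : ℕ) (hk : 1 ≤ k)
    (A : ℤ × ℤ → K)
    (hvanish : ∀ i j : ℤ, adjMinor A (k + 1) i j = 0)
    (hnonzero : ∀ i j : ℤ, adjMinor A k i j ≠ 0) :
    tilingRank K A = k := by
  let R : ℤ → ℤ → K := fun i j => A (i, j)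
  let B : Fin k → ℤ → K := fun s => R ((s : ℕ) : ℤ)
  have hB : LinearIndependent K B := by
    rw [Fintype.linearIndependent_iff]
    intro g hg
    refine congrFun (eq_zero_of_adjMinor_ne_zero (hnonzero 0 0) fun t => ?_)
    simpa [B, R, Finset.sum_apply] using congrFun hg ((t : ℕ) : ℤ)
  have hrel (i : ℤ) : ∃ c : Fin (k + 1) → K, c 0 ≠ 0 ∧ c (Fin.last k) ≠ 0 ∧
      ∑ s : Fin (k + 1), c s • R (i + ((s : ℕ) : ℤ)) = 0 := by
    obtain ⟨c, h0, hl, hc⟩ := exists_row_relation hvanish hnonzero i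
    exact ⟨c, h0, hl, funext fun j => by simpa [R, Finset.sum_apply] using hc j⟩
  let S := Submodule.span K (Set.range B)
  have hwin (n : ℤ) : ∀ s : ℕ, s < k → R (n + (s : ℤ)) ∈ S := by
    induction n using Int.induction_on with
    | zero =>
      intro s hs
      rw [zero_add]
      exact Submodule.subset_span ⟨⟨s, hs⟩, rfl⟩
    | succ n ih =>
      intro s hs
      obtain ⟨c, -, hl, hc⟩ := hrel n
      have hmem : R ((n : ℤ) + (k : ℤ)) ∈ S := by
        simpa using S.mem_of_sum_smul_eq_zero hc hl fun t ht =>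
          ih t (Fin.val_lt_last ht)
      have e : (n : ℤ) + 1 + (s : ℤ) = n + ((s + 1 : ℕ) : ℤ) := by push_cast; ring
      rw [e]
      rcases (Nat.succ_le_of_lt hs).lt_or_eq with h | h
      · exact ih _ h
      · rw [← h] at hmem
        exact hmem
    | pred n ih =>
      intro s hs
      obtain ⟨c, h0, -, hc⟩ := hrel (-(n : ℤ) - 1)
      have hprev (t : ℕ) (ht : t < k) : R (-(n : ℤ) - 1 + ((t + 1 : ℕ) : ℤ)) ∈ S := by
        have e : -(n : ℤ) - 1 + ((t + 1 : ℕ) : ℤ) = -n + (t : ℤ) := by push_cast; ring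
        rw [e]
        exact ih t ht
      cases s with
      | zero =>
        refine S.mem_of_sum_smul_eq_zero hc h0 fun t ht => ?_
        obtain ⟨t, rfl⟩ := Fin.exists_succ_eq.mpr ht
        exact hprev t t.isLt
      | succ s => exact hprev s (by omega)
  have hspan : Submodule.span K (Set.range R) = S := by
    refine le_antisymm (Submodule.span_le.mpr ?_) (Submodule.span_mono ?_)
    · rintro _ ⟨i, rfl⟩
      simpa using hwin i 0 hk
    · rintro _ ⟨s, rfl⟩
      exact ⟨_, rfl⟩
  change Module.rank K (Submodule.span K (Set.range R)) = k
  rw [hspan, rank_eq_card_basis (Module.Basis.span hB), Fintype.card_fin]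
end

section
/- Let K be a field, k ≥ 1, and let A : ℤ × ℤ → K be an SL_k-tiling. Then A is tame if and only if the bi-infinite matrix of all k×k minors of A has rank 1; concretely, A is tame if and only if for all strictly increasing maps I, I', J, J' : Fin k → ℤ one has M_{I,J}(A) · M_{I',J'}(A) = M_{I,J'}(A) · M_{I',J}(A), where M_{I,J}(A) := det (A(I(s), J(t)))_{s,t ∈ Fin k}. -/
/-- The `k × k` minor of `A` with rows selected by `I` and columns by `J`. -/
noncomputable def genMinor {K : Type*} [Field K] (k : ℕ) (A : ℤ × ℤ → K)
    (I J : Fin k → ℤ) : K :=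
  (Matrix.of fun s t : Fin k => A (I s, J t)).det

lemma of_update_left {α : Type*} {k : ℕ} (A : ℤ × ℤ → α) (I J : Fin k → ℤ) (s : Fin k) (i : ℤ) :
    (Matrix.of fun a b : Fin k => A (Function.update I s i a, J b)) =
      (Matrix.of fun a b : Fin k => A (I a, J b)).updateRow s fun b => A (i, J b) := by
  ext a b
  by_cases h : a = s
  · subst h; simp
  · simp [h]

lemma of_update_right {α : Type*} {k : ℕ} (A : ℤ × ℤ → α) (I J : Fin k → ℤ) (t : Fin k) (j : ℤ) :
    (Matrix.of fun a b : Fin k => A (I a, Function.update J t j b)) =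
      (Matrix.of fun a b : Fin k => A (I a, J b)).updateCol t fun a => A (I a, j) := by
  ext a b
  by_cases h : b = t
  · subst h; simp
  · simp [h]

section MinorMatrix

variable {K : Type*} [Field K] {k : ℕ} {A : ℤ × ℤ → K}

/-- Rows meeting `k` columns in a nonzero minor are linearly independent. -/
lemma linearIndependent_rows_of_genMinor_ne_zero {I J : Fin k → ℤ}
    (h : genMinor k A I J ≠ 0) :
    LinearIndependent K fun s : Fin k => fun j : ℤ => A (I s, j) := by
  apply LinearIndependent.of_comp (LinearMap.funLeft K K J)
  exact Matrix.linearIndependent_rows_iff_isUnit.2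
    ((Matrix.isUnit_iff_isUnit_det _).2 (isUnit_iff_ne_zero.2 h))

/-- If a `k × k` minor on the rows `I` is nonzero, then the rank is `k` exactly when the rows `I`
span all rows. -/
lemma tilingRank_eq_iff_forall_exists_sum {I J : Fin k → ℤ} (h : genMinor k A I J ≠ 0) :
    tilingRank K A = k ↔ ∀ i, ∃ c : Fin k → K, ∀ j, A (i, j) = ∑ s, c s * A (I s, j) := by
  have hli := linearIndependent_rows_of_genMinor_ne_zero h
  have hle : Submodule.span K (Set.range fun s : Fin k => fun j : ℤ => A (I s, j)) ≤
      Submodule.span K (Set.range fun i : ℤ => fun j : ℤ => A (i, j)) := by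
    apply Submodule.span_mono
    rintro _ ⟨s, rfl⟩
    exact ⟨I s, rfl⟩
  have hfin := finrank_span_eq_card hli
  rw [Fintype.card_fin] at hfin
  constructor
  · intro hr i
    have hfinite : Module.Finite K
        (Submodule.span K (Set.range fun i : ℤ => fun j : ℤ => A (i, j))) := by
      rw [← Module.rank_lt_aleph0_iff]
      exact lt_of_eq_of_lt hr Cardinal.natCast_lt_aleph0
    have heq := Submodule.eq_of_le_of_finrank_eq hle
      (hfin.trans (Module.finrank_eq_of_rank_eq hr).symm)
    have hmem : (fun j : ℤ => A (i, j)) ∈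
        Submodule.span K (Set.range fun s : Fin k => fun j : ℤ => A (I s, j)) :=
      heq ▸ Submodule.subset_span ⟨i, rfl⟩
    obtain ⟨c, hc⟩ := (Submodule.mem_span_range_iff_exists_fun K).1 hmem
    refine ⟨c, fun j => ?_⟩
    simpa using (congrFun hc j).symm
  · intro hspan
    have heq := le_antisymm hle <| Submodule.span_le.2 <| by
      rintro _ ⟨i, rfl⟩
      obtain ⟨c, hc⟩ := hspan i
      refine (Submodule.mem_span_range_iff_exists_fun K).2 ⟨c, ?_⟩
      funext j
      simp [hc j]
    have := Module.Finite.span_of_finite K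
      (Set.finite_range fun s : Fin k => fun j : ℤ => A (I s, j))
    rw [tilingRank, ← heq, ← Module.finrank_eq_rank, hfin]

lemma genMinor_comp_perm_left (I J : Fin k → ℤ) (σ : Equiv.Perm (Fin k)) :
    genMinor k A (I ∘ σ) J = (Equiv.Perm.sign σ : K) * genMinor k A I J :=
  Matrix.det_permute σ (Matrix.of fun s t : Fin k => A (I s, J t))

lemma genMinor_comp_perm_right (I J : Fin k → ℤ) (σ : Equiv.Perm (Fin k)) :
    genMinor k A I (J ∘ σ) = (Equiv.Perm.sign σ : K) * genMinor k A I J :=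
  Matrix.det_permute' σ (Matrix.of fun s t : Fin k => A (I s, J t))

lemma genMinor_eq_zero_of_not_injective_left {I : Fin k → ℤ} (hI : ¬ I.Injective)
    (J : Fin k → ℤ) : genMinor k A I J = 0 := by
  simp only [Function.Injective, not_forall] at hI
  obtain ⟨a, b, hab, hne⟩ := hI
  exact Matrix.det_zero_of_row_eq hne (by ext t; simp [hab])

lemma genMinor_eq_zero_of_not_injective_right (I : Fin k → ℤ) {J : Fin k → ℤ}
    (hJ : ¬ J.Injective) : genMinor k A I J = 0 := by
  simp only [Function.Injective, not_forall] at hJ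
  obtain ⟨a, b, hab, hne⟩ := hJ
  exact Matrix.det_zero_of_column_eq hne (by intro s; simp [hab])

/-- An injective tuple of integers is a permutation of a strictly increasing one. -/
lemma exists_strictMono_comp_perm {I : Fin k → ℤ} (hI : I.Injective) :
    ∃ (I₀ : Fin k → ℤ) (σ : Equiv.Perm (Fin k)), StrictMono I₀ ∧ I = I₀ ∘ σ :=
  ⟨I ∘ Tuple.sort I, (Tuple.sort I)⁻¹,
    (Tuple.monotone_sort I).strictMono_of_injective (hI.comp (Tuple.sort I).injective), by
      funext x; simp⟩

/-- The rank one condition on the minor matrix extends from increasing to arbitrary index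
tuples. -/
lemma genMinor_mul_genMinor_of_strictMono
    (h : ∀ I I' J J' : Fin k → ℤ, StrictMono I → StrictMono I' → StrictMono J → StrictMono J' →
      genMinor k A I J * genMinor k A I' J' = genMinor k A I J' * genMinor k A I' J)
    (I I' J J' : Fin k → ℤ) :
    genMinor k A I J * genMinor k A I' J' = genMinor k A I J' * genMinor k A I' J := by
  by_cases hI : I.Injective
  swap; · simp [genMinor_eq_zero_of_not_injective_left hI]
  by_cases hI' : I'.Injective
  swap; · simp [genMinor_eq_zero_of_not_injective_left hI']
  by_cases hJ : J.Injective
  swap; · simp [genMinor_eq_zero_of_not_injective_right _ hJ]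
  by_cases hJ' : J'.Injective
  swap; · simp [genMinor_eq_zero_of_not_injective_right _ hJ']
  obtain ⟨I, σ, hmI, rfl⟩ := exists_strictMono_comp_perm hI
  obtain ⟨I', σ', hmI', rfl⟩ := exists_strictMono_comp_perm hI'
  obtain ⟨J, τ, hmJ, rfl⟩ := exists_strictMono_comp_perm hJ
  obtain ⟨J', τ', hmJ', rfl⟩ := exists_strictMono_comp_perm hJ'
  simp only [genMinor_comp_perm_left, genMinor_comp_perm_right]
  linear_combination ((Equiv.Perm.sign σ : K) * (Equiv.Perm.sign σ' : K) *
    (Equiv.Perm.sign τ : K) * (Equiv.Perm.sign τ' : K)) * h I I' J J' hmI hmI' hmJ hmJ'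

/-- If row `i` is the combination `c` of the rows `I` on the columns `J`, up to an error `ε` in
column `t`, then replacing the `s`-th row by row `i` multiplies the minor by `c s`, up to `ε` times
a cofactor. -/
lemma genMinor_update_left {I J : Fin k → ℤ} {i : ℤ} {c : Fin k → K} {ε : K} {t : Fin k}
    (hc : ∀ b, A (i, J b) = ∑ a, c a * A (I a, J b) + ε * (Pi.single t 1 : Fin k → K) b)
    (s : Fin k) :
    genMinor k A (Function.update I s i) J = c s * genMinor k A I J +
      ε * (Matrix.of fun a b : Fin k => A (I a, J b)).adjugate t s := by
  have hv : (fun b => A (i, J b)) =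
      (∑ a, c a • (Matrix.of fun a b : Fin k => A (I a, J b)) a) +
        ε • (Pi.single t 1 : Fin k → K) := by
    funext b
    simp [hc b]
  rw [genMinor, of_update_left, hv, Matrix.det_updateRow_add, Matrix.det_updateRow_smul,
    Matrix.det_updateRow_sum, Matrix.adjugate_apply, genMinor, smul_eq_mul]

/-- If the minor matrix has rank one, then the rows of a `k × k` submatrix of determinant one
span all rows. -/
lemma exists_sum_of_genMinor_mul_genMinor (hk : 1 ≤ k) {I J : Fin k → ℤ}
    (h1 : genMinor k A I J = 1)
    (h : ∀ I I' J J' : Fin k → ℤ,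
      genMinor k A I J * genMinor k A I' J' = genMinor k A I J' * genMinor k A I' J) (i : ℤ) :
    ∃ c : Fin k → K, ∀ j, A (i, j) = ∑ s, c s * A (I s, j) := by
  let t : Fin k := ⟨0, hk⟩
  let B : Matrix (Fin k) (Fin k) K := Matrix.of fun a b => A (I a, J b)
  have hB : IsUnit B.det := by
    rw [show B.det = 1 from h1]
    exact isUnit_one
  let c : Fin k → K := Matrix.vecMul (fun b => A (i, J b)) B⁻¹
  have hc : ∀ b, A (i, J b) = ∑ a, c a * A (I a, J b) := by
    intro b
    have hcB : Matrix.vecMul c B = fun b => A (i, J b) := by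
      simp only [c, Matrix.vecMul_vecMul, Matrix.nonsing_inv_mul B hB, Matrix.vecMul_one]
    exact (congrFun hcB b).symm
  refine ⟨c, fun j => ?_⟩
  let ε : K := A (i, j) - ∑ s, c s * A (I s, j)
  let X : Matrix (Fin k) (Fin k) K := Matrix.of fun a b => A (I a, Function.update J t j b)
  have hadj : ∀ s, ε * X.adjugate t s = 0 := by
    intro s
    have hJ : genMinor k A (Function.update I s i) J = c s := by
      rw [genMinor_update_left (c := c) (ε := 0) (t := t) (by simpa using hc) s, h1]
      simp
    have hJ' : genMinor k A (Function.update I s i) (Function.update J t j) =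
        c s * genMinor k A I (Function.update J t j) + ε * X.adjugate t s := by
      apply genMinor_update_left
      intro b
      by_cases hb : b = t
      · subst hb; simp [ε]
      · simp [hb, hc b]
    have hrel := h (Function.update I s i) I (Function.update J t j) J
    rw [h1, hJ, hJ'] at hrel
    linear_combination hrel
  have hcol : X.updateCol t (fun a => A (I a, J t)) = B := by
    simp only [X, B, of_update_right, Matrix.updateCol_idem]
    exact Matrix.updateCol_eq_self _ t
  have hsum : ∑ s, X.adjugate t s * A (I s, J t) = 1 := by
    have hcr := congrFun (Matrix.cramer_eq_adjugate_mulVec X (fun a => A (I a, J t))) t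
    rw [Matrix.cramer_apply, hcol] at hcr
    exact hcr.symm.trans h1
  have hε : ε = 0 := by
    rw [← mul_one ε, ← hsum, Finset.mul_sum]
    exact Finset.sum_eq_zero fun s _ => by rw [← mul_assoc, hadj s, zero_mul]
  exact sub_eq_zero.1 hε

/-- If every row is a combination of the rows `I₀`, then every minor factors through the minor on
the rows `I₀`. -/
lemma genMinor_eq_det_mul {I₀ : Fin k → ℤ} {c : ℤ → Fin k → K}
    (hc : ∀ i j, A (i, j) = ∑ s, c i s * A (I₀ s, j)) (I J : Fin k → ℤ) :
    genMinor k A I J = (Matrix.of fun a s => c (I a) s).det * genMinor k A I₀ J := by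
  rw [genMinor, genMinor, ← Matrix.det_mul]
  congr 1
  ext a b
  simp [Matrix.mul_apply, ← hc]

end MinorMatrix

/-- An `SL_k`-tiling is tame if and only if the bi-infinite matrix of all `k × k`
minors of `A` has rank `1`, i.e. all its `2 × 2` minors vanish. -/
theorem tame_iff_minorMatrix_rank_one {K : Type*} [Field K] (k : ℕ) (hk : 1 ≤ k)
    (A : ℤ × ℤ → K) (hSL : IsSL k A) :
    tilingRank K A = k ↔
      ∀ I I' J J' : Fin k → ℤ, StrictMono I → StrictMono I' →
        StrictMono J → StrictMono J' →
        genMinor k A I J * genMinor k A I' J' = genMinor k A I J' * genMinor k A I' J := by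
  have h1 : genMinor k A (fun s => ((s : ℕ) : ℤ)) (fun s => ((s : ℕ) : ℤ)) = 1 := by
    simpa [adjMinor, genMinor] using hSL 0 0
  rw [tilingRank_eq_iff_forall_exists_sum (h1 ▸ one_ne_zero)]
  constructor
  · intro hspan I I' J J' _ _ _ _
    choose c hc using hspan
    simp only [genMinor_eq_det_mul hc I, genMinor_eq_det_mul hc I']
    ring
  · intro h
    exact exists_sum_of_genMinor_mul_genMinor hk h1 (genMinor_mul_genMinor_of_strictMono h)
end

section
/- Let K be a field, k ≥ 1, and let A : ℤ × ℤ → K be a tame SL_k-tiling. Then for all strictly increasing I, J : Fin k → ℤ and all i₀, j₀ ∈ ℤ, one has M_{I,J}(A) = M_{I,J₀}(A) · M_{I₀,J}(A), where I₀(s) = i₀ + s and J₀(t) = j₀ + t are the intervals {i₀,…,i₀+k−1} and {j₀,…,j₀+k−1}, and M_{I,J}(A) := det (A(I(s), J(t)))_{s,t ∈ Fin k}. -/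
/-- In a tame `SL_k`-tiling, every row is a linear combination of any `k` consecutive rows. -/
theorem row_mem_span_consecutive_rows {K : Type*} [Field K] {k : ℕ} {A : ℤ × ℤ → K}
    (hSL : IsSL k A) (htame : tilingRank K A = k) (i₀ i : ℤ) :
    (fun j : ℤ => A (i, j)) ∈
      Submodule.span K (Set.range fun (s : Fin k) (j : ℤ) => A (i₀ + ((s : ℕ) : ℤ), j)) := by
  set V := Submodule.span K (Set.range fun i : ℤ => fun j : ℤ => A (i, j)) with hV
  set W := Submodule.span K
    (Set.range fun (s : Fin k) (j : ℤ) => A (i₀ + ((s : ℕ) : ℤ), j)) with hW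
  have hrank : Module.rank K V = k := htame
  have hli : LinearIndependent K
      (fun (s : Fin k) (j : ℤ) => A (i₀ + ((s : ℕ) : ℤ), j)) := by
    have hdet : (Matrix.of fun s t : Fin k =>
        A (i₀ + ((s : ℕ) : ℤ), 0 + ((t : ℕ) : ℤ))).det ≠ 0 :=
      (hSL i₀ 0).trans_ne one_ne_zero
    exact LinearIndependent.of_comp
      (LinearMap.funLeft K K fun t : Fin k => (0 : ℤ) + ((t : ℕ) : ℤ))
      (Matrix.linearIndependent_rows_of_det_ne_zero hdet)
  have hWV : W ≤ V := Submodule.span_mono <| by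
    rintro _ ⟨s, rfl⟩
    exact ⟨i₀ + ((s : ℕ) : ℤ), rfl⟩
  have : FiniteDimensional K V :=
    Module.rank_lt_aleph0_iff.mp (hrank ▸ Cardinal.natCast_lt_aleph0)
  have hWV' : W = V := Submodule.eq_of_le_of_finrank_eq hWV <| by
    rw [Module.finrank_eq_of_rank_eq hrank, finrank_span_eq_card hli, Fintype.card_fin]
  rw [hWV']
  exact Submodule.subset_span ⟨i, rfl⟩

/-- For a tame `SL_k`-tiling, any `k × k` minor factors as the product of the minor
with interval columns and the minor with interval rows:
`M_{I,J} = M_{I,J₀} · M_{I₀,J}`. -/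
theorem minor_mul_of_tame {K : Type*} [Field K] (k : ℕ) (hk : 1 ≤ k)
    (A : ℤ × ℤ → K) (hSL : IsSL k A) (htame : tilingRank K A = k) :
    ∀ I J : Fin k → ℤ, StrictMono I → StrictMono J → ∀ i₀ j₀ : ℤ,
      genMinor k A I J =
        genMinor k A I (fun t => j₀ + ((t : ℕ) : ℤ)) *
          genMinor k A (fun s => i₀ + ((s : ℕ) : ℤ)) J := by
  intro I J _ _ i₀ j₀
  choose C hC using fun s : Fin k =>
    (Submodule.mem_span_range_iff_exists_fun K).mp
      (row_mem_span_consecutive_rows hSL htame i₀ (I s))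
  have hfactor (L : Fin k → ℤ) : genMinor k A I L =
      (Matrix.of C).det * genMinor k A (fun s => i₀ + ((s : ℕ) : ℤ)) L := by
    rw [genMinor, genMinor, ← Matrix.det_mul]
    congr 1
    ext s t
    simpa [Matrix.mul_apply] using (congrFun (hC s) (L t)).symm
  have hone : genMinor k A (fun s => i₀ + ((s : ℕ) : ℤ)) (fun t => j₀ + ((t : ℕ) : ℤ)) = 1 :=
    hSL i₀ j₀
  rw [hfactor J, hfactor (fun t => j₀ + ((t : ℕ) : ℤ)), hone, mul_one]
end

section
/- Let K be a field and let A : ℤ × ℤ → K be a tame SL_2-tiling. Suppose there is c ∈ ℤ such that the column C_c is the sum of its two neighbouring columns, i.e. A(i, c) = A(i, c−1) + A(i, c+1) for all i ∈ ℤ. Then the tiling B obtained by suppressing column c, defined by B(i,j) = A(i,j) for j < c and B(i,j) = A(i, j+1) for j ≥ c, is again a tame SL_2-tiling. -/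
theorem isSL_two_iff {K : Type*} [Field K] (A : ℤ × ℤ → K) :
    IsSL 2 A ↔
      ∀ i j : ℤ, A (i, j) * A (i + 1, j + 1) - A (i, j + 1) * A (i + 1, j) = 1 := by
  simp [IsSL, adjMinor, Matrix.det_fin_two]

/-- A linear map carrying the rows of `A` to the rows of `B` does not increase the rank. -/
theorem tilingRank_le_of_linearMap {K : Type*} [Field K] {A B : ℤ × ℤ → K}
    (L : (ℤ → K) →ₗ[K] (ℤ → K)) (h : ∀ i j : ℤ, L (fun k => A (i, k)) j = B (i, j)) :
    tilingRank K B ≤ tilingRank K A := by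
  have hrows : (fun i : ℤ => fun j : ℤ => B (i, j)) =
      L ∘ fun i : ℤ => fun j : ℤ => A (i, j) := by
    funext i j
    exact (h i j).symm
  unfold tilingRank
  rw [hrows, Set.range_comp, ← Submodule.map_span]
  exact rank_map_le L _

/-- If column `c` of a tame `SL₂`-tiling is the sum of its two neighbouring columns,
then suppressing column `c` yields again a tame `SL₂`-tiling. -/
theorem suppress_column_of_tame_SL2 {K : Type*} [Field K]
    (A : ℤ × ℤ → K) (hSL : IsSL 2 A) (htame : tilingRank K A = 2)
    (c : ℤ) (hc : ∀ i : ℤ, A (i, c) = A (i, c - 1) + A (i, c + 1))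
    (B : ℤ × ℤ → K)
    (hB : ∀ i j : ℤ, B (i, j) = if j < c then A (i, j) else A (i, j + 1)) :
    IsSL 2 B ∧ tilingRank K B = 2 := by
  constructor
  · rw [isSL_two_iff] at hSL ⊢
    intro i j
    simp only [hB]
    rcases lt_trichotomy (j + 1) c with h | h | h
    · rw [if_pos (by omega), if_pos (by omega), if_pos (by omega), if_pos (by omega)]
      exact hSL i j
    · subst h
      have h₀ := hc i
      have h₁ := hc (i + 1)
      have h₂ := hSL i j
      simp only [add_sub_cancel_right] at h₀ h₁
      simp only [lt_add_one, lt_irrefl, if_true, if_false]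
      rw [h₀, h₁] at h₂
      linear_combination h₂
    · rw [if_neg (by omega), if_neg (by omega), if_neg (by omega), if_neg (by omega)]
      exact hSL i (j + 1)
  · rw [← htame]
    apply le_antisymm
    · refine tilingRank_le_of_linearMap
        (LinearMap.funLeft K K fun j => if j < c then j else j + 1) fun i j => ?_
      rw [hB]
      split_ifs with h <;> simp [LinearMap.funLeft_apply, h]
    · refine tilingRank_le_of_linearMap
        (LinearMap.pi fun j =>
          let e (k : ℤ) : (ℤ → K) →ₗ[K] K := LinearMap.proj k
          if j < c then e j else if j = c then e (c - 1) + e c else e (j - 1)) fun i j => ?_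
      rcases lt_trichotomy j c with h | rfl | h
      · simp [h, hB]
      · simp [hB, hc i]
      · have h₁ : ¬ j < c := by omega
        have h₂ : j ≠ c := by omega
        have h₃ : ¬ j - 1 < c := by omega
        simp [h₁, h₂, h₃, hB]
end

section
/- Let K be a field and k ≥ 2, and set m = k − 1. For every triple (S, λ, γ) with S a k×k matrix over K of determinant 1, λ : ℤ → K^m and γ : ℤ → K^m, there exists a unique function A : ℤ × ℤ → K such that: (i) A(i,j) = S(i,j) for 0 ≤ i, j < k; (ii) for all i, j ∈ ℤ, (−1)^k A(i,j) + Σ_{l=1}^{k−1} (−1)^{k−l} λ_j(l) A(i, j+l) + A(i, j+k) = 0 (column recurrence with coefficients λ_j); (iii) for all i, j ∈ ℤ, (−1)^k A(i,j) + Σ_{l=1}^{k−1} (−1)^{k−l} γ_i(l) A(i+l, j) + A(i+k, j) = 0 (row recurrence with coefficients γ_i). Moreover this A is a tame SL_k-tiling, and every tame SL_k-tiling arises in this way from exactly one triple (S, λ, γ); i.e. the map sending a tame SL_k-tiling to its linearization data is a bijection. -/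
/-- `A` has linearization data `(S, lam, gam)`:
(i) the top-left `k × k` corner of `A` is `S`;
(ii) every column satisfies the order-`k` linear recurrence with coefficients `lam j`
     (the row vector `λ_j = (a_1, …, a_{k-1})`, indexed here by `Fin (k-1)`, where
     the entry at index `l : Fin (k-1)` plays the role of `a_{l+1}`);
(iii) every row satisfies the analogous recurrence with coefficients `gam i`. -/
def LinData {K : Type*} [Field K] (k : ℕ) (S : Matrix (Fin k) (Fin k) K)
    (lam gam : ℤ → Fin (k - 1) → K) (A : ℤ × ℤ → K) : Prop :=
  (∀ s t : Fin k, A (((s : ℕ) : ℤ), ((t : ℕ) : ℤ)) = S s t) ∧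
  (∀ i j : ℤ,
    (-1 : K) ^ k * A (i, j)
      + ∑ l : Fin (k - 1), (-1 : K) ^ (k - ((l : ℕ) + 1)) * lam j l
          * A (i, j + ((l : ℕ) : ℤ) + 1)
      + A (i, j + (k : ℤ)) = 0) ∧
  (∀ i j : ℤ,
    (-1 : K) ^ k * A (i, j)
      + ∑ l : Fin (k - 1), (-1 : K) ^ (k - ((l : ℕ) + 1)) * gam i l
          * A (i + ((l : ℕ) : ℤ) + 1, j)
      + A (i + (k : ℤ), j) = 0)

namespace SLTiling

open Matrix

variable {K : Type*} [Field K] {n : ℕ}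

/-- `f` satisfies `f (i + (n + 1)) = ∑ l, a i l * f (i + l)` for every integer `i`. -/
def LinRec (a : ℤ → Fin (n + 1) → K) (f : ℤ → K) : Prop :=
  ∀ i : ℤ, f (i + ((n + 1 : ℕ) : ℤ)) = ∑ l : Fin (n + 1), a i l * f (i + ((l : ℕ) : ℤ))

/-- The companion matrix with last row `a`. -/
def companion (a : Fin (n + 1) → K) : Matrix (Fin (n + 1)) (Fin (n + 1)) K :=
  Matrix.of (Fin.snoc (α := fun _ => Fin (n + 1) → K) (fun s => Pi.single s.succ 1) a)

/-- The window `(f i, …, f (i + n))`. -/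
def window (n : ℕ) (f : ℤ → K) (i : ℤ) : Fin (n + 1) → K := fun s => f (i + ((s : ℕ) : ℤ))

/-- The adjacent `(n + 1) × (n + 1)` block of `A` at `(i, j)`. -/
def block (n : ℕ) (A : ℤ × ℤ → K) (i j : ℤ) : Matrix (Fin (n + 1)) (Fin (n + 1)) K :=
  Matrix.of fun s t => A (i + ((s : ℕ) : ℤ), j + ((t : ℕ) : ℤ))

theorem adjMinor_eq_det_block (A : ℤ × ℤ → K) (i j : ℤ) :
    adjMinor A (n + 1) i j = (block n A i j).det := rfl

theorem block_swap {K : Type*} (A : ℤ × ℤ → K) (i j : ℤ) :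
    block n (A ∘ Prod.swap) i j = (block n A j i)ᵀ := rfl

theorem det_companion (a : Fin (n + 1) → K) : (companion a).det = (-1) ^ n * a 0 := by
  rw [det_succ_column_zero, Fin.sum_univ_castSucc, Finset.sum_eq_zero]
  · have h : (companion a).submatrix (Fin.last n).succAbove Fin.succ = 1 := by
      ext i j
      simp [companion, Pi.single_apply, Matrix.one_apply, eq_comm]
    rw [h]
    simp [companion]
  · intro s _
    simp [companion]

theorem window_add_one {a : ℤ → Fin (n + 1) → K} {f : ℤ → K} (h : LinRec a f) (i : ℤ) :
    window n f (i + 1) = companion (a i) *ᵥ window n f i := by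
  ext s
  refine Fin.lastCases ?_ (fun s => ?_) s
  · have := h i
    simp only [companion, window, mulVec, dotProduct, of_apply, Fin.snoc_last, Fin.val_last]
    rw [← this]
    push_cast
    congr 1
    ring
  · simp only [companion, window, mulVec, of_apply, Fin.snoc_castSucc, single_one_dotProduct,
      Fin.val_castSucc, Fin.val_succ]
    push_cast
    congr 1
    ring

theorem block_add_one {a : ℤ → Fin (n + 1) → K} {A : ℤ × ℤ → K}
    (h : ∀ j, LinRec a fun i => A (i, j)) (i j : ℤ) :
    block n A (i + 1) j = companion (a i) * block n A i j := by
  ext s t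
  exact congrFun (window_add_one (h (j + ((t : ℕ) : ℤ))) i) s

theorem isUnit_companion {a : Fin (n + 1) → K} (ha : a 0 ≠ 0) : IsUnit (companion a) := by
  rw [isUnit_iff_isUnit_det, det_companion]
  exact (mul_ne_zero (pow_ne_zero _ (by simp)) ha).isUnit

theorem exists_int_orbit {X : Type*} (e : ℤ → X ≃ X) (x : X) :
    ∃ V : ℤ → X, V 0 = x ∧ ∀ i, V (i + 1) = e i (V i) := by
  let V : ℤ → X
    | Int.ofNat m => Nat.rec x (fun p y => e (p : ℤ) y) m
    | Int.negSucc m =>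
      Nat.rec ((e (-1)).symm x) (fun p y => (e (Int.negSucc (p + 1))).symm y) m
  refine ⟨V, rfl, fun i => ?_⟩
  match i with
  | Int.ofNat m => rfl
  | Int.negSucc 0 => exact ((e (-1)).apply_symm_apply x).symm
  | Int.negSucc (m + 1) =>
    exact ((e (Int.negSucc (m + 1))).apply_symm_apply (V (Int.negSucc m))).symm

theorem LinRec.ext {a : ℤ → Fin (n + 1) → K} (ha : ∀ i, a i 0 ≠ 0) {f g : ℤ → K}
    (hf : LinRec a f) (hg : LinRec a g) (h : window n f 0 = window n g 0) : f = g := by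
  have key : ∀ i, window n f i = window n g i := by
    intro i
    induction i with
    | zero => exact h
    | succ i ih => rw [window_add_one hf, window_add_one hg, ih]
    | pred i ih =>
      have hf' := window_add_one hf (-(i : ℤ) - 1)
      have hg' := window_add_one hg (-(i : ℤ) - 1)
      rw [sub_add_cancel] at hf' hg'
      refine mulVec_injective_of_isUnit (isUnit_companion (ha (-(i : ℤ) - 1))) ?_
      rw [← hf', ← hg', ih]
  ext i
  simpa [window] using congrFun (key i) 0

theorem LinRec.exists {a : ℤ → Fin (n + 1) → K} (ha : ∀ i, a i 0 ≠ 0) (v : Fin (n + 1) → K) :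
    ∃ f, LinRec a f ∧ window n f 0 = v := by
  have hbij (i : ℤ) : Function.Bijective (companion (a i)).mulVec := by
    have hu := isUnit_companion (ha i)
    exact ⟨mulVec_injective_of_isUnit hu, mulVec_surjective_iff_isUnit.2 hu⟩
  obtain ⟨V, hV0, hV⟩ := exists_int_orbit (fun i => Equiv.ofBijective _ (hbij i)) v
  have hstep (i : ℤ) (s : Fin n) : V (i + 1) s.castSucc = V i s.succ := by
    rw [hV]
    simp [companion, mulVec]
  have hwin : ∀ (s : ℕ) (hs : s < n + 1) (i : ℤ), V (i + (s : ℤ)) 0 = V i ⟨s, hs⟩ := by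
    intro s
    induction s with
    | zero => intro hs i; simp
    | succ s ih =>
      intro hs i
      have := hstep i ⟨s, by omega⟩
      rw [Fin.succ_mk] at this
      rw [← this, Fin.castSucc_mk, ← ih (by omega)]
      exact congrArg (V · 0) (by push_cast; ring)
  refine ⟨fun i => V i 0, fun i => ?_, ?_⟩
  · have h1 := hwin n (by omega) (i + 1)
    have h2 : V (i + 1) (Fin.last n) = ∑ l, a i l * V i l := by
      rw [hV]
      simp [companion, mulVec, dotProduct]
    have h3 : i + ((n + 1 : ℕ) : ℤ) = i + 1 + (n : ℤ) := by push_cast; ring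
    simp only [h3, h1]
    refine h2.trans (Finset.sum_congr rfl fun l _ => ?_)
    rw [hwin l l.2]
  · ext s
    rw [window, hwin s s.2, hV0]

/-- A column relation that holds on the rows `0, …, n` holds on every row. -/
theorem col_relation {a : ℤ → Fin (n + 1) → K} (ha : ∀ i, a i 0 ≠ 0) {A : ℤ × ℤ → K}
    (h : ∀ j, LinRec a fun i => A (i, j)) (b : Fin (n + 1) → K) (j : ℤ)
    (hb : ∀ s : Fin (n + 1), A (((s : ℕ) : ℤ), j + ((n + 1 : ℕ) : ℤ)) =
      ∑ l : Fin (n + 1), b l * A (((s : ℕ) : ℤ), j + ((l : ℕ) : ℤ))) (i : ℤ) :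
    A (i, j + ((n + 1 : ℕ) : ℤ)) = ∑ l : Fin (n + 1), b l * A (i, j + ((l : ℕ) : ℤ)) := by
  have hg : LinRec a fun i => ∑ l : Fin (n + 1), b l * A (i, j + ((l : ℕ) : ℤ)) := by
    intro i
    simp only [Finset.mul_sum]
    rw [Finset.sum_comm]
    refine Finset.sum_congr rfl fun l _ => ?_
    rw [show A (i + ((n + 1 : ℕ) : ℤ), j + ((l : ℕ) : ℤ)) = _ from h (j + ((l : ℕ) : ℤ)) i,
      Finset.mul_sum]
    exact Finset.sum_congr rfl fun m _ => by ring
  refine congrFun (LinRec.ext ha (h _) hg ?_) i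
  ext s
  simpa [window] using hb s

theorem det_block_add_one {a : ℤ → Fin (n + 1) → K} {A : ℤ × ℤ → K}
    (h : ∀ j, LinRec a fun i => A (i, j)) (i j : ℤ) :
    (block n A (i + 1) j).det = (-1) ^ n * a i 0 * (block n A i j).det := by
  rw [block_add_one h, det_mul, det_companion]

theorem det_block_eq {a : ℤ → Fin (n + 1) → K} (ha : ∀ i, a i 0 = (-1) ^ n) {A : ℤ × ℤ → K}
    (h : ∀ j, LinRec a fun i => A (i, j)) (i j : ℤ) :
    (block n A i j).det = (block n A 0 j).det := by
  have step (i : ℤ) : (block n A (i + 1) j).det = (block n A i j).det := by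
    rw [det_block_add_one h, ha, ← mul_pow]
    simp
  induction i with
  | zero => rfl
  | succ i ih => rw [step, ih]
  | pred i ih => rw [← ih, ← step, sub_add_cancel]

theorem isSL_of_linRec {a b : ℤ → Fin (n + 1) → K} (ha : ∀ i, a i 0 = (-1) ^ n)
    (hb : ∀ i, b i 0 = (-1) ^ n) {A : ℤ × ℤ → K} (hA : ∀ j, LinRec a fun i => A (i, j))
    (hB : ∀ i, LinRec b fun j => A (i, j)) (h0 : (block n A 0 0).det = 1) : IsSL (n + 1) A := by
  intro i j
  have h2 := det_block_eq hb (A := A ∘ Prod.swap) hB j 0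
  rw [block_swap, block_swap, det_transpose, det_transpose] at h2
  rw [adjMinor_eq_det_block, det_block_eq ha hA, h2, h0]

theorem linearIndependent_rows {A : ℤ × ℤ → K} {i j : ℤ} (h : (block n A i j).det = 1) :
    LinearIndependent K fun (s : Fin (n + 1)) (j : ℤ) => A (i + ((s : ℕ) : ℤ), j) := by
  have hu : IsUnit (block n A i j) := by
    rw [isUnit_iff_isUnit_det, h]
    exact isUnit_one
  have hl := linearIndependent_rows_iff_isUnit.2 hu
  let T : (ℤ → K) →ₗ[K] (Fin (n + 1) → K) :=
    LinearMap.funLeft K K fun t : Fin (n + 1) => j + ((t : ℕ) : ℤ)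
  exact LinearIndependent.of_comp T hl

theorem tilingRank_eq {b : ℤ → Fin (n + 1) → K} (hb : ∀ i, b i 0 ≠ 0) {A : ℤ × ℤ → K}
    (hB : ∀ i, LinRec b fun j => A (i, j)) (h0 : (block n A 0 0).det = 1) :
    tilingRank K A = (n + 1 : ℕ) := by
  let R : Submodule K (ℤ → K) := Submodule.span K (Set.range fun i : ℤ => fun j : ℤ => A (i, j))
  change Module.rank K R = _
  refine le_antisymm ?_ ?_
  · have hsol : ∀ f ∈ R, LinRec b f := by
      intro f hf
      induction hf using Submodule.span_induction with
      | mem f hf => obtain ⟨i, rfl⟩ := hf; exact hB i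
      | zero => intro i; simp
      | add f g _ _ hf hg =>
        intro i
        simp only [Pi.add_apply, hf i, hg i, mul_add, Finset.sum_add_distrib]
      | smul c f _ hf =>
        intro i
        simp only [Pi.smul_apply, hf i, smul_eq_mul, Finset.mul_sum]
        exact Finset.sum_congr rfl fun l _ => by ring
    let T : R →ₗ[K] (Fin (n + 1) → K) :=
      (LinearMap.funLeft K K fun t : Fin (n + 1) => (0 : ℤ) + ((t : ℕ) : ℤ)) ∘ₗ R.subtype
    have hT : Function.Injective T := fun f g hfg =>
      Subtype.ext (LinRec.ext hb (hsol f f.2) (hsol g g.2) hfg)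
    simpa using LinearMap.rank_le_of_injective T hT
  · have hl : LinearIndependent K fun s : Fin (n + 1) =>
        (⟨_, Submodule.subset_span ⟨0 + ((s : ℕ) : ℤ), rfl⟩⟩ : R) :=
      LinearIndependent.of_comp R.subtype (linearIndependent_rows h0)
    simpa using hl.cardinal_lift_le_rank

theorem exists_row_coeffs {A : ℤ × ℤ → K} (hSL : IsSL (n + 1) A)
    (hr : tilingRank K A = (n + 1 : ℕ)) :
    ∃ a : ℤ → Fin (n + 1) → K, ∀ j, LinRec a fun i => A (i, j) := by
  let R : Submodule K (ℤ → K) := Submodule.span K (Set.range fun i : ℤ => fun j : ℤ => A (i, j))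
  have hfr : Module.finrank K R = n + 1 := Module.finrank_eq_of_rank_eq hr
  let row : ℤ → R := fun i => ⟨fun j => A (i, j), Submodule.subset_span ⟨i, rfl⟩⟩
  have key (i : ℤ) : ∃ c : Fin (n + 1) → K,
      ∑ l, c l • row (i + ((l : ℕ) : ℤ)) = row (i + ((n + 1 : ℕ) : ℤ)) := by
    have hl : LinearIndependent K fun s : Fin (n + 1) => row (i + ((s : ℕ) : ℤ)) :=
      LinearIndependent.of_comp R.subtype (linearIndependent_rows (hSL i 0))
    have htop := hl.span_eq_top_of_card_eq_finrank (by simp [hfr])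
    rw [← Submodule.mem_span_range_iff_exists_fun, htop]
    trivial
  choose a ha using key
  refine ⟨a, fun j i => ?_⟩
  have := congrFun (congrArg Subtype.val (ha i)) j
  simpa [row, Finset.sum_apply] using this.symm

theorem linRec_coeff_zero {A : ℤ × ℤ → K} (hSL : IsSL (n + 1) A) {a : ℤ → Fin (n + 1) → K}
    (h : ∀ j, LinRec a fun i => A (i, j)) (i : ℤ) : a i 0 = (-1) ^ n := by
  have h1 := det_block_add_one h i 0
  rw [← adjMinor_eq_det_block, ← adjMinor_eq_det_block, hSL, hSL, mul_one] at h1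
  calc a i 0 = ((-1) ^ n * (-1) ^ n) * a i 0 := by rw [← mul_pow]; simp
    _ = (-1) ^ n := by rw [mul_assoc, ← h1, mul_one]

theorem linRec_coeff_unique {A : ℤ × ℤ → K} (hSL : IsSL (n + 1) A) {a b : ℤ → Fin (n + 1) → K}
    (ha : ∀ j, LinRec a fun i => A (i, j)) (hb : ∀ j, LinRec b fun i => A (i, j)) : a = b := by
  funext i
  have hu : IsUnit (block n A i 0) := by
    rw [isUnit_iff_isUnit_det, ← adjMinor_eq_det_block, hSL]
    exact isUnit_one
  refine vecMul_injective_of_isUnit hu ?_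
  ext t
  exact (ha (0 + ((t : ℕ) : ℤ)) i).symm.trans (hb (0 + ((t : ℕ) : ℤ)) i)

theorem isSL_swap {A : ℤ × ℤ → K} (hSL : IsSL (n + 1) A) : IsSL (n + 1) (A ∘ Prod.swap) := by
  intro i j
  rw [adjMinor_eq_det_block, block_swap, det_transpose]
  exact hSL j i

theorem exists_col_coeffs {A : ℤ × ℤ → K} (hSL : IsSL (n + 1) A) {a : ℤ → Fin (n + 1) → K}
    (ha : ∀ i, a i 0 ≠ 0) (h : ∀ j, LinRec a fun i => A (i, j)) :
    ∃ b : ℤ → Fin (n + 1) → K, ∀ i, LinRec b fun j => A (i, j) := by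
  have key (j : ℤ) : ∃ b : Fin (n + 1) → K,
      block n A 0 j *ᵥ b = fun s : Fin (n + 1) => A (((s : ℕ) : ℤ), j + ((n + 1 : ℕ) : ℤ)) := by
    have hu : IsUnit (block n A 0 j) := by
      rw [isUnit_iff_isUnit_det, ← adjMinor_eq_det_block, hSL]
      exact isUnit_one
    exact mulVec_surjective_iff_isUnit.2 hu _
  choose b hb using key
  refine ⟨b, fun i j => col_relation ha h (b j) j (fun s => ?_) i⟩
  rw [← congrFun (hb j) s]
  simp [block, mulVec, dotProduct, mul_comm]

/-- The coefficients of the recurrence solved for its leading term. -/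
def coeff (c : Fin n → K) : Fin (n + 1) → K :=
  Fin.cons ((-1) ^ n) fun l => -((-1) ^ (n + 1 - ((l : ℕ) + 1)) * c l)

@[simp]
theorem coeff_zero (c : Fin n → K) : coeff c 0 = (-1) ^ n := rfl

theorem coeff_injective : Function.Injective (coeff : (Fin n → K) → Fin (n + 1) → K) := by
  intro c d h
  ext l
  simpa [coeff] using congrFun h l.succ

theorem exists_coeff_eq {a : Fin (n + 1) → K} (ha : a 0 = (-1) ^ n) : ∃ c, coeff c = a := by
  refine ⟨fun l => -((-1) ^ (n + 1 - ((l : ℕ) + 1)) * a l.succ), ?_⟩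
  ext l
  refine Fin.cases ha.symm (fun l => ?_) l
  simp only [coeff, Fin.cons_succ, mul_neg, neg_neg, ← mul_assoc, ← mul_pow]
  simp

theorem recurrence_iff (c : Fin n → K) (f : ℤ → K) (i : ℤ) :
    (-1 : K) ^ (n + 1) * f i
      + ∑ l : Fin n, (-1 : K) ^ (n + 1 - ((l : ℕ) + 1)) * c l * f (i + ((l : ℕ) : ℤ) + 1)
      + f (i + ((n + 1 : ℕ) : ℤ)) = 0 ↔
    f (i + ((n + 1 : ℕ) : ℤ)) = ∑ l : Fin (n + 1), coeff c l * f (i + ((l : ℕ) : ℤ)) := by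
  have h : ∑ l : Fin (n + 1), coeff c l * f (i + ((l : ℕ) : ℤ)) =
      -((-1 : K) ^ (n + 1) * f i
      + ∑ l : Fin n, (-1 : K) ^ (n + 1 - ((l : ℕ) + 1)) * c l * f (i + ((l : ℕ) : ℤ) + 1)) := by
    rw [Fin.sum_univ_succ, neg_add, ← Finset.sum_neg_distrib]
    congr 1
    · simp [pow_succ]
    · refine Finset.sum_congr rfl fun l _ => ?_
      simp [coeff, add_assoc]
  rw [h, add_comm, add_eq_zero_iff_eq_neg]

theorem linData_iff (S : Matrix (Fin (n + 1)) (Fin (n + 1)) K) (lam gam : ℤ → Fin n → K)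
    (A : ℤ × ℤ → K) :
    LinData (n + 1) S lam gam A ↔ block n A 0 0 = S ∧
      (∀ i, LinRec (fun j => coeff (lam j)) fun j => A (i, j)) ∧
      ∀ j, LinRec (fun i => coeff (gam i)) fun i => A (i, j) := by
  refine and_congr ?_ (and_congr ?_ ?_)
  · simp [← Matrix.ext_iff, block]
  · exact forall_congr' fun i => forall_congr' fun j =>
      recurrence_iff (lam j) (fun j => A (i, j)) j
  · rw [forall_comm]
    exact forall_congr' fun j => forall_congr' fun i =>
      recurrence_iff (gam i) (fun i => A (i, j)) i

theorem existsUnique_tiling {a b : ℤ → Fin (n + 1) → K} (ha : ∀ i, a i 0 ≠ 0)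
    (hb : ∀ j, b j 0 ≠ 0) (S : Matrix (Fin (n + 1)) (Fin (n + 1)) K) :
    ∃! A : ℤ × ℤ → K, block n A 0 0 = S ∧ (∀ i, LinRec b fun j => A (i, j)) ∧
      ∀ j, LinRec a fun i => A (i, j) := by
  refine existsUnique_of_exists_of_unique ?_ ?_
  · choose g hg hg0 using fun s => LinRec.exists hb (S s)
    choose f hf hf0 using fun j => LinRec.exists ha fun s => g s j
    have hfg (s : Fin (n + 1)) (j : ℤ) : f j ((s : ℕ) : ℤ) = g s j := by
      simpa [window] using congrFun (hf0 j) s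
    refine ⟨fun p => f p.2 p.1, ?_, ?_, hf⟩
    · ext s t
      simpa [block, hfg, window] using congrFun (hg0 s) t
    · intro i j
      refine col_relation (A := fun p => f p.2 p.1) ha hf (b j) j (fun s => ?_) i
      simpa only [hfg] using hg s j
  · rintro A B ⟨hA0, hAb, hAa⟩ ⟨hB0, hBb, hBa⟩
    have hrow (s : Fin (n + 1)) (j : ℤ) :
        A (0 + ((s : ℕ) : ℤ), j) = B (0 + ((s : ℕ) : ℤ), j) :=
      congrFun (LinRec.ext hb (hAb (0 + ((s : ℕ) : ℤ))) (hBb (0 + ((s : ℕ) : ℤ)))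
        (congrFun (hA0.trans hB0.symm) s)) j
    ext ⟨i, j⟩
    exact congrFun (LinRec.ext ha (hAa j) (hBa j) (funext fun s => hrow s j)) i

end SLTiling

open SLTiling in
/-- Bijection between tame `SL_k`-tilings and linearization data: for every triple
`(S, λ, γ)` with `det S = 1` there is a unique tiling with this linearization data,
it is a tame `SL_k`-tiling, and every tame `SL_k`-tiling arises from exactly one
such triple. -/
theorem linearization_data_bijection {K : Type*} [Field K] (k : ℕ) (hk : 2 ≤ k) :
    (∀ S : Matrix (Fin k) (Fin k) K, S.det = 1 →
      ∀ lam gam : ℤ → Fin (k - 1) → K,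
        (∃! A : ℤ × ℤ → K, LinData k S lam gam A) ∧
        (∀ A : ℤ × ℤ → K, LinData k S lam gam A →
          IsSL k A ∧ tilingRank K A = k)) ∧
    (∀ A : ℤ × ℤ → K, IsSL k A → tilingRank K A = k →
      ∃! p : Matrix (Fin k) (Fin k) K × (ℤ → Fin (k - 1) → K) × (ℤ → Fin (k - 1) → K),
        p.1.det = 1 ∧ LinData k p.1 p.2.1 p.2.2 A) := by
  obtain ⟨n, rfl⟩ : ∃ n, k = n + 1 := ⟨k - 1, by omega⟩
  have hunit : (-1 : K) ^ n ≠ 0 := pow_ne_zero _ (by simp)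
  refine ⟨fun S hS lam gam => ⟨?_, fun A hA => ?_⟩, fun A hSL hr => ?_⟩
  · exact (existsUnique_congr fun A => linData_iff S lam gam A).2
      (existsUnique_tiling (fun _ => hunit) (fun _ => hunit) S)
  · obtain ⟨h0, hb, ha⟩ := (linData_iff S lam gam A).1 hA
    have hdet : (block n A 0 0).det = 1 := by rw [h0, hS]
    exact ⟨isSL_of_linRec (fun _ => rfl) (fun _ => rfl) ha hb hdet,
      tilingRank_eq (fun _ => hunit) hb hdet⟩
  · obtain ⟨a, ha⟩ := exists_row_coeffs hSL hr
    have ha0 := linRec_coeff_zero hSL ha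
    obtain ⟨b, hb⟩ := exists_col_coeffs hSL (fun i => by rw [ha0]; exact hunit) ha
    have hb0 := linRec_coeff_zero (isSL_swap hSL) hb
    choose gam hgam using fun i => exists_coeff_eq (ha0 i)
    choose lam hlam using fun j => exists_coeff_eq (hb0 j)
    obtain rfl : (fun i => coeff (gam i)) = a := funext hgam
    obtain rfl : (fun j => coeff (lam j)) = b := funext hlam
    refine ⟨(block n A 0 0, lam, gam), ⟨hSL 0 0, (linData_iff _ _ _ _).2 ⟨rfl, hb, ha⟩⟩, ?_⟩
    rintro ⟨S, lam', gam'⟩ ⟨-, h⟩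
    obtain ⟨rfl, hb', ha'⟩ := (linData_iff S lam' gam' A).1 h
    have h1 := linRec_coeff_unique hSL ha' ha
    have h2 := linRec_coeff_unique (isSL_swap hSL) hb' hb
    obtain rfl : gam' = gam := funext fun i => coeff_injective (congrFun h1 i)
    obtain rfl : lam' = lam := funext fun i => coeff_injective (congrFun h2 i)
    rfl
end

section
/- Let K be a field and k ≥ 2. If A : ℤ × ℤ → K is a tame SL_k-tiling, then its dual A*, defined by A*(i,j) := M^{(k−1)}_{ij}(A) (the adjacent (k−1)×(k−1) minor of A at (i,j)), is again a tame SL_k-tiling: all adjacent k×k minors of A* equal 1, and A* has rank k. -/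
/-- The dual tiling of `A`: its entries are the adjacent `(k-1) × (k-1)` minors of `A`. -/
noncomputable def dualTiling {K : Type*} [Field K] (k : ℕ) (A : ℤ × ℤ → K) :
    ℤ × ℤ → K :=
  fun p => adjMinor A (k - 1) p.1 p.2

open Matrix

/-- The square matrix whose rows are `k` consecutive members of a sequence of vectors. -/
def rowBlock {K : Type*} {k : ℕ} (p : ℤ → Fin k → K) (i : ℤ) : Matrix (Fin k) (Fin k) K :=
  Matrix.of fun s => p (i + ((s : ℕ) : ℤ))

/-- The sequence of generalized cross products of `n` consecutive vectors of `K ^ (n + 1)`. -/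
def crossSeq {K : Type*} [Field K] {n : ℕ} (p : ℤ → Fin (n + 1) → K) (i : ℤ) :
    Fin (n + 1) → K :=
  fun l => (rowBlock p i).adjugate l (Fin.last n)

lemma dotProduct_crossSeq {K : Type*} [Field K] {n : ℕ} (p : ℤ → Fin (n + 1) → K) (i : ℤ)
    (s : Fin (n + 1)) :
    p (i + ((s : ℕ) : ℤ)) ⬝ᵥ crossSeq p i = if s = Fin.last n then (rowBlock p i).det else 0 := by
  have h := congrFun (congrFun (Matrix.mul_adjugate (rowBlock p i)) s) (Fin.last n)
  rw [Matrix.mul_apply] at h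
  simpa [dotProduct, crossSeq, rowBlock, Matrix.one_apply] using h

lemma det_rowBlock_mul_det_rowBlock_crossSeq {K : Type*} [Field K] {n : ℕ}
    (p : ℤ → Fin (n + 1) → K) (i : ℤ) :
    (rowBlock p (i + n)).det * (rowBlock (crossSeq p) i).det =
      ∏ s : Fin (n + 1), (rowBlock p (i + ((s : ℕ) : ℤ))).det := by
  have entry (t s : Fin (n + 1)) (hts : t ≤ s) :
      (rowBlock p (i + n) * (rowBlock (crossSeq p) i)ᵀ) t s =
        if t = s then (rowBlock p (i + ((s : ℕ) : ℤ))).det else 0 := by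
    have hlt : n + (t : ℕ) - s < n + 1 := by
      have : (t : ℕ) ≤ s := hts
      omega
    have h := dotProduct_crossSeq p (i + ((s : ℕ) : ℤ)) ⟨n + t - s, hlt⟩
    have hidx : i + ((s : ℕ) : ℤ) + ((n + t - s : ℕ) : ℤ) = i + n + ((t : ℕ) : ℤ) := by
      have := s.isLt
      omega
    have hiff : (⟨n + t - s, hlt⟩ : Fin (n + 1)) = Fin.last n ↔ t = s := by
      have := s.isLt
      have : (t : ℕ) ≤ s := hts
      simp only [Fin.ext_iff, Fin.val_last]
      omega
    simp only [hidx, hiff] at h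
    rw [← h]
    rfl
  rw [← Matrix.det_transpose (rowBlock (crossSeq p) i), ← Matrix.det_mul,
    Matrix.det_of_isLowerTriangular]
  · exact Finset.prod_congr rfl fun s _ => by simpa using entry s s le_rfl
  · intro t s hts
    have hlt : t < s := hts
    rw [entry t s hlt.le, if_neg hlt.ne]

lemma adjMinor_dotProduct {K : Type*} [Field K] {k : ℕ} (p q : ℤ → Fin k → K) (i j : ℤ) :
    adjMinor (fun x => p x.1 ⬝ᵥ q x.2) k i j = (rowBlock p i).det * (rowBlock q j).det := by
  rw [← Matrix.det_transpose (rowBlock q j), ← Matrix.det_mul]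
  rfl

lemma dualTiling_dotProduct {K : Type*} [Field K] {n : ℕ} (p q : ℤ → Fin (n + 1) → K) :
    dualTiling (n + 1) (fun x => p x.1 ⬝ᵥ q x.2) =
      fun x => crossSeq p x.1 ⬝ᵥ crossSeq q x.2 := by
  funext ⟨i, j⟩
  have h : adjMinor (fun x => p x.1 ⬝ᵥ q x.2) n i j =
      (rowBlock p i * (rowBlock q j)ᵀ).adjugate (Fin.last n) (Fin.last n) := by
    rw [Matrix.adjugate_fin_succ_eq_det_submatrix]
    simp only [Fin.succAbove_last, Fin.val_last, ← two_mul, pow_mul, neg_one_sq, one_pow, one_mul]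
    rfl
  change adjMinor _ n i j = _
  rw [h, Matrix.adjugate_mul_distrib, ← Matrix.adjugate_transpose, Matrix.mul_apply]
  exact Finset.sum_congr rfl fun l _ => mul_comm _ _

lemma exists_eq_dotProduct_of_tilingRank_eq {K : Type*} [Field K] {k : ℕ} {A : ℤ × ℤ → K}
    (h : tilingRank K A = k) :
    ∃ p q : ℤ → Fin k → K, A = fun x => p x.1 ⬝ᵥ q x.2 := by
  let S := Submodule.span K (Set.range fun i : ℤ => fun j : ℤ => A (i, j))
  have hS : Module.rank K S = k := h
  have : Module.Finite K S := Module.rank_lt_aleph0_iff.mp (hS ▸ Cardinal.natCast_lt_aleph0)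
  let b : Module.Basis (Fin k) K S :=
    Module.finBasisOfFinrankEq K S (Module.finrank_eq_of_rank_eq hS)
  let r (i : ℤ) : S := ⟨fun j => A (i, j), Submodule.subset_span ⟨i, rfl⟩⟩
  refine ⟨fun i => b.repr (r i), fun j l => (b l : ℤ → K) j, ?_⟩
  funext ⟨i, j⟩
  have hr : ((∑ l, b.repr (r i) l • b l : S) : ℤ → K) j = A (i, j) := by rw [b.sum_repr]
  rw [← hr]
  simp only [AddSubmonoidClass.coe_finsetSum, Finset.sum_apply, Submodule.coe_smul,
    Pi.smul_apply, smul_eq_mul, dotProduct]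

lemma tilingRank_dotProduct_le {K : Type*} [Field K] {k : ℕ} (p q : ℤ → Fin k → K) :
    tilingRank K (fun x => p x.1 ⬝ᵥ q x.2) ≤ k := by
  have hle : Submodule.span K (Set.range fun i j : ℤ => p i ⬝ᵥ q j) ≤
      Submodule.span K (Set.range fun (l : Fin k) (j : ℤ) => q j l) := by
    rw [Submodule.span_le]
    rintro _ ⟨i, rfl⟩
    have : (fun j => p i ⬝ᵥ q j) = ∑ l, p i l • fun j => q j l := by
      funext j
      simp [dotProduct]
    simp only [this]
    exact Submodule.sum_mem _ fun l _ =>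
      Submodule.smul_mem _ _ (Submodule.subset_span ⟨l, rfl⟩)
  refine (Submodule.rank_mono hle).trans ((rank_span_le _).trans ?_)
  simpa using Cardinal.mk_range_le_lift (f := fun (l : Fin k) (j : ℤ) => q j l)

lemma le_tilingRank_of_adjMinor_ne_zero {K : Type*} [Field K] {k : ℕ} {A : ℤ × ℤ → K} {i j : ℤ}
    (h : adjMinor A k i j ≠ 0) : (k : Cardinal) ≤ tilingRank K A := by
  have hli : LinearIndependent K
      (fun (s : Fin k) (t : Fin k) => A (i + ((s : ℕ) : ℤ), j + ((t : ℕ) : ℤ))) :=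
    Matrix.linearIndependent_rows_of_det_ne_zero h
  have hrows : LinearIndependent K (fun (s : Fin k) (c : ℤ) => A (i + ((s : ℕ) : ℤ), c)) :=
    LinearIndependent.of_comp (LinearMap.funLeft K K fun t : Fin k => j + ((t : ℕ) : ℤ)) hli
  have hspan : LinearIndependent K fun s : Fin k =>
      (⟨fun c => A (i + ((s : ℕ) : ℤ), c), Submodule.subset_span ⟨_, rfl⟩⟩ :
        Submodule.span K (Set.range fun i : ℤ => fun j : ℤ => A (i, j))) :=
    LinearIndependent.of_comp (Submodule.subtype _) hrows
  simpa [tilingRank] using hspan.cardinal_lift_le_rank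

/-- The dual of a tame `SL_k`-tiling is again a tame `SL_k`-tiling. -/
theorem dual_of_tame_SLk_is_tame_SLk {K : Type*} [Field K] (k : ℕ) (hk : 2 ≤ k)
    (A : ℤ × ℤ → K) (hSL : IsSL k A) (htame : tilingRank K A = k) :
    IsSL k (dualTiling k A) ∧ tilingRank K (dualTiling k A) = k := by
  obtain ⟨n, rfl⟩ : ∃ n, k = n + 1 := ⟨k - 1, by omega⟩
  obtain ⟨p, q, rfl⟩ := exists_eq_dotProduct_of_tilingRank_eq htame
  have hdet (i j : ℤ) : (rowBlock p i).det * (rowBlock q j).det = 1 := by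
    rw [← adjMinor_dotProduct]
    exact hSL i j
  rw [dualTiling_dotProduct]
  have hdual : IsSL (n + 1) fun x => crossSeq p x.1 ⬝ᵥ crossSeq q x.2 := by
    intro i j
    rw [adjMinor_dotProduct]
    calc (rowBlock (crossSeq p) i).det * (rowBlock (crossSeq q) j).det
        = ((rowBlock p (i + n)).det * (rowBlock (crossSeq p) i).det) *
            ((rowBlock q (j + n)).det * (rowBlock (crossSeq q) j).det) := by
          rw [mul_mul_mul_comm, hdet, one_mul]
      _ = 1 := by
          rw [det_rowBlock_mul_det_rowBlock_crossSeq, det_rowBlock_mul_det_rowBlock_crossSeq,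
            ← Finset.prod_mul_distrib]
          exact Finset.prod_eq_one fun s _ => hdet _ _
  refine ⟨hdual, (tilingRank_dotProduct_le _ _).antisymm ?_⟩
  exact le_tilingRank_of_adjMinor_ne_zero (i := 0) (j := 0) (by rw [hdual]; exact one_ne_zero)
end

section
/- Let K be a field, k ≥ 2, and let A : ℤ × ℤ → K be a tame SL_k-tiling with dual A* defined by A*(i,j) := M^{(k−1)}_{ij}(A). Then for all natural numbers r, s with r + s = k and all i, j ∈ ℤ, one has M^{(r)}_{ij}(A*) = M^{(s)}_{i+r−1, j+r−1}(A). In particular (taking r = k−1, s = 1), the bidual (A*)* coincides with A up to the translation (i,j) ↦ (i+k−2, j+k−2). -/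
open Matrix in
/-- The linear-algebra core of Jacobi's complementary minor identity: if `[Y₁ Y₂]` sends the
matrix `[S B; C D]` of determinant one to `[0 T']` with `det T' = 1`, then `det Y₂ = det S`. -/
lemma det_eq_det_of_fromBlocks {R m n : Type*} [CommRing R] [Fintype m] [Fintype n]
    [DecidableEq m] [DecidableEq n] (S : Matrix m m R) (B : Matrix m n R) (C : Matrix n m R)
    (D : Matrix n n R) (Y₁ : Matrix n m R) (Y₂ T' : Matrix n n R)
    (hdet : (fromBlocks S B C D).det = 1) (hzero : Y₁ * S + Y₂ * C = 0)
    (hT : Y₁ * B + Y₂ * D = T') (hT' : T'.det = 1) : Y₂.det = S.det := by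
  have h : fromBlocks 1 0 Y₁ Y₂ * fromBlocks S B C D = fromBlocks S B 0 T' := by
    rw [fromBlocks_multiply]
    simp [hzero, hT]
  have h' := congrArg Matrix.det h
  rwa [det_mul, hdet, det_fromBlocks_zero₁₂, det_fromBlocks_zero₂₁, hT', det_one, one_mul,
    mul_one, mul_one] at h'

/-- In a tame `SL_k`-tiling every row is a linear combination of any `k` consecutive rows. -/
lemma exists_row_coefficients {K : Type*} [Field K] {k : ℕ} {A : ℤ × ℤ → K} (hSL : IsSL k A)
    (htame : tilingRank K A = k) (i₀ : ℤ) :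
    ∃ c : ℤ → Fin k → K, ∀ p q, A (p, q) = ∑ l, c p l * A (i₀ + ((l : ℕ) : ℤ), q) := by
  set V := Submodule.span K (Set.range fun i : ℤ => fun j : ℤ => A (i, j)) with hV
  have hrank : Module.rank K V = k := htame
  have : FiniteDimensional K V := FiniteDimensional.of_rank_eq_nat hrank
  let v : Fin k → ℤ → K := fun l j => A (i₀ + ((l : ℕ) : ℤ), j)
  have hv : LinearIndependent K v := by
    apply LinearIndependent.of_comp (LinearMap.funLeft K K fun t : Fin k => ((t : ℕ) : ℤ))
    have h := hSL i₀ 0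
    unfold adjMinor at h
    have h2 := Matrix.linearIndependent_rows_of_det_ne_zero (h.trans_ne one_ne_zero)
    simpa [Function.comp_def, LinearMap.funLeft, v, Matrix.row_def] using! h2
  have hle : Submodule.span K (Set.range v) ≤ V :=
    Submodule.span_mono (by rintro _ ⟨l, rfl⟩; exact ⟨i₀ + ((l : ℕ) : ℤ), rfl⟩)
  have heq : Submodule.span K (Set.range v) = V :=
    Submodule.eq_of_le_of_finrank_eq hle
      (by rw [finrank_span_eq_card hv, Fintype.card_fin, Module.finrank_eq_of_rank_eq hrank])
  have hmem (p : ℤ) : ∃ c : Fin k → K, ∑ l, c l • v l = fun j => A (p, j) := by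
    rw [← Submodule.mem_span_range_iff_exists_fun, heq]
    exact Submodule.subset_span ⟨p, rfl⟩
  choose c hc using hmem
  refine ⟨c, fun p q => ?_⟩
  rw [← congrFun (hc p) q]
  simp [v]

/-- The corner minor of a product of square matrices, by the multiplicativity of adjugates. -/
lemma det_submatrix_castSucc_mul {R : Type*} [CommRing R] {n : ℕ}
    (X Y : Matrix (Fin (n + 1)) (Fin (n + 1)) R) :
    ((X * Y).submatrix Fin.castSucc Fin.castSucc).det =
      ∑ l, Y.adjugate (Fin.last n) l * X.adjugate l (Fin.last n) := by
  have h := Matrix.adjugate_fin_succ_eq_det_submatrix (X * Y) (Fin.last n) (Fin.last n)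
  rw [Matrix.adjugate_mul_distrib, Matrix.mul_apply, ← two_mul, pow_mul] at h
  simpa using h.symm

/-- The adjacent minors of the dual of a tame tiling are complementary adjacent minors of the
tiling itself. -/
lemma adjMinor_dualTiling {K : Type*} [Field K] {n r s : ℕ} {A : ℤ × ℤ → K}
    (hSL : IsSL (n + 1) A) (htame : tilingRank K A = (n + 1 : ℕ)) (hrs : r + s = n + 1)
    (i j : ℤ) :
    adjMinor (dualTiling (n + 1) A) r i j =
      adjMinor A s (i + (r : ℤ) - 1) (j + (r : ℤ) - 1) := by
  set i₀ : ℤ := i + r - 1 with hi₀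
  set j₀ : ℤ := j + r - 1 with hj₀
  obtain ⟨c, hc⟩ := exists_row_coefficients hSL htame i₀
  let X : ℤ → Matrix (Fin (n + 1)) (Fin (n + 1)) K :=
    fun a => Matrix.of fun t l => c (a + ((t : ℕ) : ℤ)) l
  let Y : ℤ → Matrix (Fin (n + 1)) (Fin (n + 1)) K :=
    fun b => Matrix.of fun l t => A (i₀ + ((l : ℕ) : ℤ), b + ((t : ℕ) : ℤ))
  have hXY (a b : ℤ) : X a * Y b = Matrix.of fun s t : Fin (n + 1) =>
      A (a + ((s : ℕ) : ℤ), b + ((t : ℕ) : ℤ)) := by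
    ext s t
    simp only [X, Y, Matrix.mul_apply, Matrix.of_apply]
    exact (hc _ _).symm
  have hY (b : ℤ) : (Y b).det = 1 := hSL i₀ b
  have hX (a : ℤ) : (X a).det = 1 := by
    have h := congrArg Matrix.det (hXY a 0)
    rw [Matrix.det_mul, hY, mul_one] at h
    exact h.trans (hSL a 0)
  have hX₀ : X i₀ = 1 := by
    have h : X i₀ * Y 0 = 1 * Y 0 := by rw [hXY, one_mul]
    have hu : IsUnit (Y 0) := by rw [Matrix.isUnit_iff_isUnit_det, hY]; exact isUnit_one
    exact hu.mul_right_cancel h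
  let x : ℤ → Fin (n + 1) → K := fun a l => (X a).adjugate l (Fin.last n)
  let y : ℤ → Fin (n + 1) → K := fun b l => (Y b).adjugate (Fin.last n) l
  have hdual (a b : ℤ) : dualTiling (n + 1) A (a, b) = ∑ l, y b l * x a l := by
    have h := det_submatrix_castSucc_mul (X a) (Y b)
    rw [hXY] at h
    exact h
  have hx (a : ℤ) (l t : Fin (n + 1)) (h : i₀ + ((l : ℕ) : ℤ) = a + ((t : ℕ) : ℤ)) :
      x a l = if t = Fin.last n then 1 else 0 := by
    have h1 := congrFun (congrFun (Matrix.mul_adjugate (X a)) t) (Fin.last n)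
    rw [hX, one_smul, Matrix.one_apply, Matrix.mul_apply] at h1
    rw [← h1]
    have h2 (m : Fin (n + 1)) : X a t m = (1 : Matrix (Fin (n + 1)) (Fin (n + 1)) K) l m := by
      rw [← hX₀]; simp only [X, Matrix.of_apply, h]
    simp [h2, Matrix.one_apply, x]
  have hy (b q : ℤ) (t : Fin (n + 1)) (h : q = b + ((t : ℕ) : ℤ)) :
      ∑ l : Fin (n + 1), y b l * A (i₀ + ((l : ℕ) : ℤ), q) =
        if t = Fin.last n then 1 else 0 := by
    have h1 := congrFun (congrFun (Matrix.adjugate_mul (Y b)) (Fin.last n)) t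
    rw [hY, one_smul, Matrix.one_apply, Matrix.mul_apply] at h1
    rw [h, ← if_congr (eq_comm (a := Fin.last n) (b := t)) rfl rfl, ← h1]
    rfl
  let e : Fin s ⊕ Fin r ≃ Fin (n + 1) := finSumFinEquiv.trans (finCongr (by omega))
  have hel (u : Fin s) : ((e (Sum.inl u) : Fin (n + 1)) : ℕ) = u := by simp [e]
  have her (u : Fin r) : ((e (Sum.inr u) : Fin (n + 1)) : ℕ) = s + u := by simp [e]
  let B : Matrix (Fin s ⊕ Fin r) (Fin s ⊕ Fin r) K := (Y j₀).submatrix e e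
  let Y₁ : Matrix (Fin r) (Fin s) K :=
    Matrix.of fun b u => y (j + ((b : ℕ) : ℤ)) (e (Sum.inl u))
  let Y₂ : Matrix (Fin r) (Fin r) K :=
    Matrix.of fun b u => y (j + ((b : ℕ) : ℤ)) (e (Sum.inr u))
  let T : Matrix (Fin r) (Fin r) K :=
    Matrix.of fun u a => x (i + ((a : ℕ) : ℤ)) (e (Sum.inr u))
  have hsum (b : Fin r) (w : Fin s ⊕ Fin r) :
      (Y₁ * B.submatrix Sum.inl id + Y₂ * B.submatrix Sum.inr id) b w =
        ∑ l, y (j + ((b : ℕ) : ℤ)) l * A (i₀ + ((l : ℕ) : ℤ), j₀ + ((e w : ℕ) : ℤ)) := by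
    rw [← e.sum_comp, Fintype.sum_sum_type]
    rfl
  have hval (b : Fin r) (w : Fin s ⊕ Fin r) (h : (e w : ℕ) ≤ s + b) :
      (Y₁ * B.submatrix Sum.inl id + Y₂ * B.submatrix Sum.inr id) b w =
        if (e w : ℕ) = s + b then 1 else 0 := by
    rw [hsum, hy _ _ ⟨e w + (r - 1 - b), by omega⟩ (by push_cast; omega)]
    refine if_congr ?_ rfl rfl
    simp only [Fin.ext_iff, Fin.val_last]
    omega
  have hS : Y₂.det = (B.toBlocks₁₁).det := by
    refine det_eq_det_of_fromBlocks B.toBlocks₁₁ B.toBlocks₁₂ B.toBlocks₂₁ B.toBlocks₂₂ Y₁ Y₂ _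
      ?_ ?_ rfl ?_
    · rw [Matrix.fromBlocks_toBlocks, Matrix.det_submatrix_equiv_self, hY]
    · ext b u
      have h := hval b (Sum.inl u) (by rw [hel]; omega)
      rw [hel, if_neg (by omega)] at h
      exact h
    · have htri (b u : Fin r) (h : u ≤ b) :
          (Y₁ * B.toBlocks₁₂ + Y₂ * B.toBlocks₂₂) b u = if u = b then 1 else 0 := by
        have h' := hval b (Sum.inr u) (by rw [her]; omega)
        rw [her] at h'
        simpa only [add_right_inj, ← Fin.ext_iff] using! h'
      rw [Matrix.det_of_isUpperTriangular]
      · exact Finset.prod_eq_one fun b _ => by rw [htri b b le_rfl, if_pos rfl]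
      · intro b u h
        have h : u < b := h
        rw [htri b u h.le, if_neg h.ne]
  have hxval (a : Fin r) (w : Fin s ⊕ Fin r) (h : (e w : ℕ) ≤ s + a) :
      x (i + ((a : ℕ) : ℤ)) (e w) = if (e w : ℕ) = s + a then 1 else 0 := by
    rw [hx _ _ ⟨e w + (r - 1 - a), by omega⟩ (by push_cast; omega)]
    refine if_congr ?_ rfl rfl
    simp only [Fin.ext_iff, Fin.val_last]
    omega
  have hT : T.det = 1 := by
    have htri (a u : Fin r) (h : u ≤ a) : T u a = if u = a then 1 else 0 := by
      have h' := hxval a (Sum.inr u) (by rw [her]; omega)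
      rw [her] at h'
      simpa only [add_right_inj, ← Fin.ext_iff] using! h'
    rw [Matrix.det_of_isLowerTriangular]
    · exact Finset.prod_eq_one fun b _ => by rw [htri b b le_rfl, if_pos rfl]
    · intro u a h
      have h : u < a := h
      rw [htri a u h.le, if_neg h.ne]
  have hN : (Matrix.of fun a b : Fin r =>
      dualTiling (n + 1) A (i + ((a : ℕ) : ℤ), j + ((b : ℕ) : ℤ))) = (Y₂ * T).transpose := by
    ext a b
    rw [Matrix.of_apply, hdual, ← e.sum_comp, Fintype.sum_sum_type, Matrix.transpose_apply,
      Matrix.mul_apply, Finset.sum_eq_zero, zero_add]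
    · rfl
    · intro u _
      rw [hxval a (Sum.inl u) (by rw [hel]; omega), hel, if_neg (by omega), mul_zero]
  unfold adjMinor
  rw [hN, Matrix.det_transpose, Matrix.det_mul, hT, mul_one, hS]
  congr 1

/-- For a tame `SL_k`-tiling `A` and `r + s = k`, the adjacent `r × r` minors of the
dual `A*` are the adjacent `s × s` minors of `A` translated by `(r-1, r-1)`.
In particular the bidual `(A*)*` coincides with `A` up to the translation
`(i, j) ↦ (i + k - 2, j + k - 2)`. -/
theorem adjMinor_dual_eq_translated_adjMinor {K : Type*} [Field K] (k : ℕ)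
    (hk : 2 ≤ k) (A : ℤ × ℤ → K) (hSL : IsSL k A) (htame : tilingRank K A = k) :
    (∀ r s : ℕ, r + s = k → ∀ i j : ℤ,
      adjMinor (dualTiling k A) r i j =
        adjMinor A s (i + (r : ℤ) - 1) (j + (r : ℤ) - 1)) ∧
    (∀ i j : ℤ,
      dualTiling k (dualTiling k A) (i, j) = A (i + (k : ℤ) - 2, j + (k : ℤ) - 2)) := by
  obtain ⟨n, rfl⟩ : ∃ n, k = n + 1 := ⟨k - 1, by omega⟩
  refine ⟨fun r s hrs i j => adjMinor_dualTiling hSL htame hrs i j, fun i j => ?_⟩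
  have h := adjMinor_dualTiling hSL htame (rfl : n + 1 = n + 1) i j
  refine Eq.trans h ?_
  have h1 (a : ℤ) : a + (n : ℤ) - 1 = a + ((n + 1 : ℕ) : ℤ) - 2 := by push_cast; ring
  simp [adjMinor, h1]
end

section
/- Let K be a field and let A : ℤ × ℤ → K satisfy the SL_3-condition: every adjacent 3×3 minor of A equals 1 (no tameness is assumed). Define A*(i,j) := A(i,j)A(i+1,j+1) − A(i,j+1)A(i+1,j). Then for all i, j ∈ ℤ, A*(i,j)A*(i+1,j+1) − A*(i,j+1)A*(i+1,j) = A(i+1, j+1); that is, the bidual of any SL_3-tiling coincides with the tiling itself up to translation by (1,1). -/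
/-- The dual of an `SL₃`-tiling: the adjacent `2 × 2` minors
`A*(i,j) = A(i,j)A(i+1,j+1) − A(i,j+1)A(i+1,j)`. -/
def dual2 {K : Type*} [Field K] (A : ℤ × ℤ → K) (i j : ℤ) : K :=
  A (i, j) * A (i + 1, j + 1) - A (i, j + 1) * A (i + 1, j)

/-- For any `SL₃`-tiling (tame or not), the bidual coincides with the tiling itself
up to translation by `(1,1)`. -/
theorem bidual_of_SL3 {K : Type*} [Field K] (A : ℤ × ℤ → K)
    (hSL : ∀ i j : ℤ, adjMinor A 3 i j = 1) :
    ∀ i j : ℤ,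
      dual2 A i j * dual2 A (i + 1) (j + 1)
        - dual2 A i (j + 1) * dual2 A (i + 1) j = A (i + 1, j + 1) := by
  intro i j
  have h := hSL i j
  simp only [adjMinor, Matrix.det_fin_three, Matrix.of_apply, Fin.val_zero, Fin.val_one,
    Fin.val_two, Nat.cast_zero, Nat.cast_one, Nat.cast_ofNat, add_zero] at h
  simp only [dual2, add_assoc, one_add_one_eq_two]
  linear_combination A (i + 1, j + 1) * h
end

section
/- Let K be a field and k ≥ 2. Let A be a (2k−1)×(2k−1) matrix over K of rank k such that every adjacent k×k minor of A equals 1, i.e. det (A(i+s, j+t))_{0≤s,t<k} = 1 for all 0 ≤ i, j ≤ k−1. Let B be the top-left k×k block of A, B(s,t) = A(s,t) for 0 ≤ s,t < k; let C be the (k+1)×(k+1) matrix of adjacent (k−1)×(k−1) minors of A, C(i,j) = det (A(i+s, j+t))_{0≤s,t<k−1} for 0 ≤ i,j ≤ k; and let D(i,j) = C(i+1, j+1) for 0 ≤ i,j < k. Then for every h with 0 ≤ h ≤ k: det (D(s,t))_{0≤s,t<h} = det (B(h+s, h+t))_{0≤s,t<k−h}; that is, the top-left h×h minor of D equals the bottom-right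 (k−h)×(k−h) minor of B. -/
/-- Entry of a finite square matrix read with natural-number indices
(returning `0` out of range; all accesses below are within range). -/
def entry {K : Type*} [Field K] {n : ℕ} (A : Matrix (Fin n) (Fin n) K) (i j : ℕ) : K :=
  if h : i < n ∧ j < n then A ⟨i, h.1⟩ ⟨j, h.2⟩ else 0

namespace Matrix

/-- Complementary minors: if `det B = 1`, `Bᵀ * Z = V`, and `X` and `V` are block lower and block
upper triangular respectively with top-left blocks of determinant `1`, then the top-left block of
`X * Z` and the bottom-right block of `B` have the same determinant. -/
theorem det_toBlocks₁₁_mul_of_triangular {R m n : Type*} [CommRing R] [Fintype m] [Fintype n]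
    [DecidableEq m] [DecidableEq n] {B X Z V : Matrix (m ⊕ n) (m ⊕ n) R}
    (hB : B.det = 1) (hV : Bᵀ * Z = V)
    (hX₁₂ : X.toBlocks₁₂ = 0) (hX₁₁ : X.toBlocks₁₁.det = 1)
    (hV₂₁ : V.toBlocks₂₁ = 0) (hV₁₁ : V.toBlocks₁₁.det = 1) :
    (X * Z).toBlocks₁₁.det = B.toBlocks₂₂.det := by
  have hXZ : (X * Z).toBlocks₁₁ = X.toBlocks₁₁ * Z.toBlocks₁₁ := by
    conv_lhs => rw [← fromBlocks_toBlocks X, ← fromBlocks_toBlocks Z, fromBlocks_multiply]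
    simp [hX₁₂]
  have hBZ := hV
  rw [← fromBlocks_toBlocks Bᵀ, ← fromBlocks_toBlocks Z, fromBlocks_multiply,
    ← fromBlocks_toBlocks V, fromBlocks_inj, hV₂₁] at hBZ
  obtain ⟨h₁₁, -, h₂₁, -⟩ := hBZ
  have key : Bᵀ * fromBlocks Z.toBlocks₁₁ 0 Z.toBlocks₂₁ 1
      = fromBlocks V.toBlocks₁₁ Bᵀ.toBlocks₁₂ 0 Bᵀ.toBlocks₂₂ := by
    conv_lhs => rw [← fromBlocks_toBlocks Bᵀ]
    rw [fromBlocks_multiply, h₁₁, h₂₁]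
    simp
  have hdet := congrArg det key
  rw [det_mul, det_transpose, hB, det_fromBlocks_zero₁₂, det_fromBlocks_zero₂₁, hV₁₁] at hdet
  have hT : Bᵀ.toBlocks₂₂ = B.toBlocks₂₂ᵀ := rfl
  rw [hXZ, det_mul, hX₁₁, one_mul, ← det_transpose B.toBlocks₂₂, ← hT]
  simpa using hdet

/-- The columns of a matrix are combinations of any linearly independent family of columns whose
cardinality is the rank. -/
theorem exists_eq_submatrix_mul_of_rank_eq {K m n ι : Type*} [Field K] [Fintype m] [Fintype n]
    [Fintype ι] (A : Matrix m n K) (c : ι → n)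
    (hc : LinearIndependent K fun l => A.col (c l)) (hr : A.rank = Fintype.card ι) :
    ∃ Q : Matrix ι n K, A = A.submatrix id c * Q := by
  have hle : Submodule.span K (Set.range fun l => A.col (c l))
      ≤ Submodule.span K (Set.range A.col) :=
    Submodule.span_mono (by rintro _ ⟨l, rfl⟩; exact ⟨c l, rfl⟩)
  have heq := Submodule.eq_of_le_of_finrank_eq hle
    (by rw [finrank_span_eq_card hc, ← hr, rank_eq_finrank_span_cols])
  have hmem : ∀ j, ∃ q : ι → K, ∑ l, q l • A.col (c l) = A.col j := fun j =>
    (Submodule.mem_span_range_iff_exists_fun K).1 (heq ▸ Submodule.subset_span ⟨j, rfl⟩)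
  choose q hq using hmem
  refine ⟨of fun l j => q j l, ?_⟩
  ext i j
  have := congrFun (hq j) i
  simp only [Finset.sum_apply, Pi.smul_apply, col_apply, smul_eq_mul] at this
  rw [← this, mul_apply]
  exact Finset.sum_congr rfl fun l _ => mul_comm _ _

end Matrix

open Matrix

/-- The condensation identity for an array which is the product of its first `r + 1` columns
and a coefficient array. -/
theorem condensation_minors_of_factorization {R : Type*} [CommRing R] {r h m : ℕ}
    (hm : h + m = r + 1) (a : ℕ → ℕ → R) (q : Fin (r + 1) → ℕ → R)
    (haq : ∀ i j, a i j = ∑ l : Fin (r + 1), a i l * q l j)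
    (hdet : ∀ i j, i < r + 1 → j < r + 1 →
      (of fun s t : Fin (r + 1) => a (i + s) (j + t)).det = 1) :
    (of fun s t : Fin h => (of fun u v : Fin r => a (s + 1 + u) (t + 1 + v)).det).det
      = (of fun s t : Fin m => a (h + s) (h + t)).det := by
  let P : ℕ → Matrix (Fin (r + 1)) (Fin (r + 1)) R := fun s => of fun u l => a (s + u) l
  let Q : ℕ → Matrix (Fin (r + 1)) (Fin (r + 1)) R := fun t => of fun l v => q l (t + v)
  have hPQ : ∀ s t, P s * Q t = of fun u v : Fin (r + 1) => a (s + u) (t + v) := by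
    intro s t
    ext u v
    simp [P, Q, mul_apply, ← haq]
  have hP : ∀ s, s < r + 1 → (P s).det = 1 := by
    intro s hs
    simpa [P] using hdet s 0 hs (by omega)
  have hQ : ∀ t, t < r + 1 → (Q t).det = 1 := by
    intro t ht
    have := congrArg det (hPQ 0 t)
    rwa [det_mul, hP 0 (by omega), one_mul, hdet 0 t (by omega) ht] at this
  have hQ0 : Q 0 = 1 := by
    have h1 : P 0 * Q 0 = P 0 := by rw [hPQ]; simp [P]
    calc Q 0 = (P 0).adjugate * (P 0 * Q 0) := by
          rw [← Matrix.mul_assoc, adjugate_mul, hP 0 (by omega)]; simp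
      _ = 1 := by rw [h1, adjugate_mul, hP 0 (by omega)]; simp
  let U : Matrix (Fin (r + 1)) (Fin (r + 1)) R := of fun s l => (P s).adjugate l 0
  let V : Matrix (Fin (r + 1)) (Fin (r + 1)) R := of fun l t => (Q t).adjugate 0 l
  have hU : ∀ s t : Fin (r + 1), s ≤ t → (U * (P 0)ᵀ) s t = if s = t then 1 else 0 := by
    intro s t hst
    have hst' : (s : ℕ) ≤ t := hst
    have h1 := congrFun (congrFun (mul_adjugate (P s)) ⟨t - s, by omega⟩) 0
    rw [hP s s.2, one_smul, mul_apply, one_apply] at h1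
    have h2 : (s : ℕ) + (t - s) = t := by omega
    simp only [P, of_apply, h2] at h1
    simp only [mul_apply, U, P, of_apply, transpose_apply, zero_add]
    rw [Finset.sum_congr rfl fun l _ => mul_comm _ _, h1]
    congr 1
    simp only [Fin.ext_iff, Fin.val_zero, eq_iff_iff]
    omega
  have hV : ∀ l t : Fin (r + 1), t ≤ l → V l t = if l = t then 1 else 0 := by
    intro l t htl
    have htl' : (t : ℕ) ≤ l := htl
    have h1 := congrFun (congrFun (adjugate_mul (Q t)) 0) ⟨l - t, by omega⟩
    rw [hQ t t.2, one_smul, mul_apply, one_apply] at h1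
    have h2 : (t : ℕ) + (l - t) = l := by omega
    have h3 : ∀ i, q i l = if i = l then 1 else 0 := by
      intro i
      have := congrFun (congrFun hQ0 i) l
      simpa [Q, one_apply] using this
    simp only [Q, of_apply, h2, h3, mul_ite, mul_one, mul_zero, Finset.sum_ite_eq',
      Finset.mem_univ, if_true] at h1
    simp only [V, Q, of_apply]
    rw [h1]
    congr 1
    simp only [Fin.ext_iff, Fin.val_zero, eq_iff_iff]
    omega
  have hUV : ∀ s t : Fin (r + 1),
      (U * V) s t = (of fun u v : Fin r => a (s + 1 + u) (t + 1 + v)).det := by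
    intro s t
    have h1 : (U * V) s t = (P s * Q t).adjugate 0 0 := by
      rw [adjugate_mul_distrib, mul_apply, mul_apply]
      exact Finset.sum_congr rfl fun l _ => mul_comm _ _
    rw [h1, hPQ, adjugate_fin_succ_eq_det_submatrix]
    simp only [Fin.val_zero, add_zero, pow_zero, one_mul, Fin.succAbove_zero]
    congr 1
    ext u v
    simp only [submatrix_apply, of_apply, Fin.val_succ]
    congr 1 <;> ring
  have hXZ : (U * (P 0)ᵀ) * ((P 0)ᵀ.adjugate * V) = U * V := by
    rw [Matrix.mul_assoc, ← Matrix.mul_assoc _ _ V, mul_adjugate, det_transpose, hP 0 (by omega)]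
    simp
  have hBZ : (P 0)ᵀ * ((P 0)ᵀ.adjugate * V) = V := by
    rw [← Matrix.mul_assoc, mul_adjugate, det_transpose, hP 0 (by omega)]
    simp
  let e : Fin h ⊕ Fin m ≃ Fin (r + 1) := finSumFinEquiv.trans (finCongr hm)
  have hel : ∀ s : Fin h, (e (.inl s) : ℕ) = s := fun s => by simp [e]
  have her : ∀ s : Fin m, (e (.inr s) : ℕ) = h + s := fun s => by simp [e]
  have key := det_toBlocks₁₁_mul_of_triangular (B := (P 0).submatrix e e)
    (X := (U * (P 0)ᵀ).submatrix e e) (Z := ((P 0)ᵀ.adjugate * V).submatrix e e)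
    (V := V.submatrix e e)
    (by rw [det_submatrix_equiv_self, hP 0 (by omega)])
    (by rw [transpose_submatrix, submatrix_mul_equiv, hBZ])
    (by
      ext s t
      have hlt : e (.inl s) < e (.inr t) := by rw [Fin.lt_def, hel, her]; omega
      simp only [toBlocks₁₂, of_apply, submatrix_apply, Matrix.zero_apply]
      rw [hU _ _ hlt.le, if_neg hlt.ne])
    (by
      rw [det_of_isLowerTriangular]
      · exact Finset.prod_eq_one fun s _ => by simp [toBlocks₁₁, hU]
      · intro s t hst
        have hlt : e (.inl s) < e (.inl t) := by rw [Fin.lt_def, hel, hel]; exact hst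
        simp only [toBlocks₁₁, of_apply, submatrix_apply]
        rw [hU _ _ hlt.le, if_neg hlt.ne])
    (by
      ext s t
      have hlt : e (.inl t) < e (.inr s) := by rw [Fin.lt_def, hel, her]; omega
      simp only [toBlocks₂₁, of_apply, submatrix_apply, Matrix.zero_apply]
      rw [hV _ _ hlt.le, if_neg hlt.ne'])
    (by
      rw [det_of_isUpperTriangular]
      · exact Finset.prod_eq_one fun s _ => by simp [toBlocks₁₁, hV]
      · intro s t hst
        have hlt : e (.inl t) < e (.inl s) := by rw [Fin.lt_def, hel, hel]; exact hst
        simp only [toBlocks₁₁, of_apply, submatrix_apply]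
        rw [hV _ _ hlt.le, if_neg hlt.ne'])
  rw [submatrix_mul_equiv, hXZ] at key
  convert key using 2
  · ext s t
    simp only [toBlocks₁₁, of_apply, submatrix_apply, hUV, hel]
  · ext s t
    simp only [toBlocks₂₂, of_apply, submatrix_apply, P, her, zero_add]

/-- Let `A` be a `(2k-1) × (2k-1)` matrix of rank `k` all of whose adjacent `k × k`
minors equal `1`, `B` its top-left `k × k` block, `C` the `(k+1) × (k+1)` matrix of
adjacent `(k-1) × (k-1)` minors of `A`, and `D (i,j) = C (i+1, j+1)`.  Then for all
`h ≤ k`, the top-left `h × h` minor of `D` equals the bottom-right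
`(k-h) × (k-h)` minor of `B`. -/
theorem condensation_minors {K : Type*} [Field K] (k : ℕ) (hk : 2 ≤ k)
    (A : Matrix (Fin (2 * k - 1)) (Fin (2 * k - 1)) K)
    (hrank : A.rank = k)
    (hSL : ∀ i j : ℕ, i < k → j < k →
      (Matrix.of fun s t : Fin k => entry A (i + (s : ℕ)) (j + (t : ℕ))).det = 1) :
    ∀ h : ℕ, h ≤ k →
      (Matrix.of fun s t : Fin h =>
        (Matrix.of fun u v : Fin (k - 1) =>
          entry A ((s : ℕ) + 1 + (u : ℕ)) ((t : ℕ) + 1 + (v : ℕ))).det).det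
      = (Matrix.of fun s t : Fin (k - h) =>
          entry A (h + (s : ℕ)) (h + (t : ℕ))).det := by
  intro h hh
  obtain ⟨r, rfl⟩ : ∃ r, k = r + 1 := ⟨k - 1, by omega⟩
  let c : Fin (r + 1) → Fin (2 * (r + 1) - 1) := Fin.castLE (by omega)
  have hli : LinearIndependent K fun l => A.col (c l) := by
    have hB : LinearIndependent K (A.submatrix c c).col := by
      rw [linearIndependent_cols_iff_isUnit, isUnit_iff_isUnit_det]
      have h0 := hSL 0 0 (by omega) (by omega)
      have h1 : A.submatrix c c
          = of fun s t : Fin (r + 1) => entry A (0 + (s : ℕ)) (0 + (t : ℕ)) := by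
        ext s t
        have hs : (s : ℕ) < 2 * (r + 1) - 1 := by omega
        have ht : (t : ℕ) < 2 * (r + 1) - 1 := by omega
        simp [entry, hs, ht, c, Fin.castLE]
      rw [h1, h0]
      exact isUnit_one
    exact LinearIndependent.of_comp (LinearMap.funLeft K K c) hB
  obtain ⟨Q, hQ⟩ := A.exists_eq_submatrix_mul_of_rank_eq c hli (by simpa using hrank)
  refine condensation_minors_of_factorization (by omega) (entry A)
    (fun l j => if hj : j < 2 * (r + 1) - 1 then Q l ⟨j, hj⟩ else 0) (fun i j => ?_) hSL
  by_cases hj : j < 2 * (r + 1) - 1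
  · by_cases hi : i < 2 * (r + 1) - 1
    · have hij := congrFun (congrFun hQ ⟨i, hi⟩) ⟨j, hj⟩
      have hl : ∀ l : Fin (r + 1), (l : ℕ) < 2 * (r + 1) - 1 := fun l => by omega
      simpa [entry, hi, hj, hl, mul_apply, c, Fin.castLE] using hij
    · simp [entry, hi]
  · simp [entry, hj]
end

section
/- Let y₁ = [[0, −1], [1, 1]] and y₂ = [[0, −1], [1, 2]] be elements of SL(2, ℤ). Then the group homomorphism from the free group on two generators a, b to SL(2, ℤ) sending a ↦ y₁ and b ↦ y₂ is surjective, and its kernel is the normal closure of the set {a⁶, a³·(a·b)⁻²}. Equivalently, SL(2, ℤ) has the presentation ⟨y₁, y₂ | y₁³ = −1, (y₁y₂)² = −1⟩ where −1 denotes the negative of the identity matrix. -/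
/-- The element `Y(t) = [[0, −1], [1, t]]` of `SL(2, ℤ)`. -/
def Ymat (t : ℤ) : Matrix.SpecialLinearGroup (Fin 2) ℤ :=
  ⟨!![0, -1; 1, t], by simp [Matrix.det_fin_two_of]⟩

open Matrix MatrixGroups

namespace ModularGroup

section NormalForm

variable {G : Type*} [Group G]

/-- The normal forms `ζ c m d` in a group with elements `u`, `s` satisfying `u ^ 3 = s ^ 2`:
`ζ` is a power of `u ^ 3`, `c` a power of `u`, `m` a product of `s u⁻¹` and `u ^ 3 s u`, and
`d` is `1` or `s`. -/
def IsNormalForm (u s g : G) : Prop :=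
  ∃ ζ c m d : G, (ζ = 1 ∨ ζ = u ^ 3) ∧ (c = 1 ∨ c = u ∨ c = u⁻¹) ∧
    m ∈ Submonoid.closure {s * u⁻¹, u ^ 3 * s * u} ∧ (d = 1 ∨ d = s) ∧ g = ζ * (c * (m * d))

variable {u s : G}

lemma IsNormalForm.cube_mul (hu : u ^ 6 = 1) {g : G} (hg : IsNormalForm u s g) :
    IsNormalForm u s (u ^ 3 * g) := by
  obtain ⟨ζ, c, m, d, hζ, hc, hm, hd, rfl⟩ := hg
  rcases hζ with rfl | rfl
  · exact ⟨_, c, m, d, Or.inr rfl, hc, hm, hd, by group⟩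
  · refine ⟨1, c, m, d, Or.inl rfl, hc, hm, hd, ?_⟩
    rw [← mul_assoc, ← pow_add, hu]

lemma IsNormalForm.cube_pow_mul_left {x : G} (hx : Commute x (u ^ 3)) {ζ g : G}
    (hu : u ^ 6 = 1) (hζ : ζ = 1 ∨ ζ = u ^ 3) (hg : IsNormalForm u s (x * g)) :
    IsNormalForm u s (x * (ζ * g)) := by
  rcases hζ with rfl | rfl
  · simpa using hg
  · rw [← mul_assoc, hx.eq, mul_assoc]
    exact hg.cube_mul hu

lemma IsNormalForm.mul_left_u (hu : u ^ 6 = 1) {g : G} (hg : IsNormalForm u s g) :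
    IsNormalForm u s (u * g) := by
  obtain ⟨ζ, c, m, d, hζ, hc, hm, hd, rfl⟩ := hg
  refine IsNormalForm.cube_pow_mul_left (Commute.self_pow u 3) hu hζ ?_
  rcases hc with rfl | rfl | rfl
  · exact ⟨1, u, m, d, by simp, by simp, hm, hd, by group⟩
  · exact ⟨c ^ 3, c⁻¹, m, d, by simp, by simp, hm, hd, by simp [pow_succ, mul_assoc]⟩
  · exact ⟨1, 1, m, d, by simp, by simp, hm, hd, by group⟩

lemma IsNormalForm.mul_left_s (hu : u ^ 6 = 1) (hus : u ^ 3 = s ^ 2) {g : G}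
    (hg : IsNormalForm u s g) : IsNormalForm u s (s * g) := by
  obtain ⟨ζ, c, m, d, hζ, hc, hm, hd, rfl⟩ := hg
  refine IsNormalForm.cube_pow_mul_left (hus ▸ Commute.self_pow s 2) hu hζ ?_
  have hz : u ^ 3 * u ^ 3 = 1 := by rw [← pow_add, hu]
  have hss : s * s = u ^ 3 := by rw [hus, sq]
  rcases hc with rfl | rfl | rfl
  · induction hm using Submonoid.closure_induction_left with
    | one =>
      rcases hd with rfl | rfl
      · exact ⟨1, 1, 1, s, by simp, by simp, one_mem _, by simp, by simp⟩
      · exact ⟨u ^ 3, 1, 1, 1, by simp, by simp, one_mem _, by simp, by simp [hss]⟩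
    | mul_left x hx m hm _ =>
      rcases hx with rfl | rfl
      · exact ⟨u ^ 3, u⁻¹, m, d, by simp, by simp, hm, hd, by simp [← hss, mul_assoc]⟩
      · refine ⟨1, u, m, d, by simp, by simp, hm, hd, ?_⟩
        have h : s * (u ^ 3 * s) = 1 := by
          rw [← hz, hus]; group
        calc s * (1 * (u ^ 3 * s * u * m * d)) = s * (u ^ 3 * s) * (u * (m * d)) := by group
          _ = 1 * (u * (m * d)) := by rw [h]
  · refine ⟨c ^ 3, 1, c ^ 3 * s * c * m, d, by simp, by simp,
      mul_mem (Submonoid.subset_closure (by simp)) hm, hd, ?_⟩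
    calc s * (c * (m * d)) = c ^ 3 * c ^ 3 * (s * (c * (m * d))) := by rw [hz, one_mul]
      _ = _ := by group
  · exact ⟨1, 1, s * u⁻¹ * m, d, by simp, by simp,
      mul_mem (Submonoid.subset_closure (by simp)) hm, hd, by group⟩

lemma isNormalForm_of_closure_eq_top (hu : u ^ 6 = 1) (hus : u ^ 3 = s ^ 2)
    (h : Subgroup.closure {u, s} = ⊤) (g : G) : IsNormalForm u s g := by
  have hinv {x : G} {n : ℕ} (hx : x ^ (n + 1) = 1) : x⁻¹ = x ^ n := by
    rw [inv_eq_iff_mul_eq_one, ← pow_succ', hx]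
  have hs : s ^ 4 = 1 := by rw [← hu, show s ^ 4 = (s ^ 2) ^ 2 by group, ← hus]; group
  have hg : g ∈ Subgroup.closure {u, s} := h ▸ Subgroup.mem_top g
  induction hg using Subgroup.closure_induction_left with
  | one => exact ⟨1, 1, 1, 1, by simp, by simp, one_mem _, by simp, by simp⟩
  | mul_left x hx y _ ih =>
    rcases hx with rfl | rfl
    · exact ih.mul_left_u hu
    · exact ih.mul_left_s hu hus
  | inv_mul_cancel x hx y _ ih =>
    rcases hx with rfl | rfl
    · rw [hinv (n := 5) hu]
      simp only [pow_succ, pow_zero, one_mul, mul_assoc]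
      iterate 5 refine IsNormalForm.mul_left_u hu ?_
      exact ih
    · rw [hinv (n := 3) hs]
      simp only [pow_succ, pow_zero, one_mul, mul_assoc]
      iterate 3 refine IsNormalForm.mul_left_s hu hus ?_
      exact ih

end NormalForm

/-- An element of order `6` of `SL(2, ℤ)`. -/
def U : SL(2, ℤ) := ⟨!![1, -1; 1, 0], by simp [Matrix.det_fin_two_of]⟩

variable {G : Type*} [Group G] {u s : G} {φ : G →* SL(2, ℤ)}

/-- A nontrivial product of `s u⁻¹` and `u ^ 3 s u` acts by a matrix with positive diagonal and
nonpositive, not both zero, off-diagonal entries. -/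
lemma eq_one_or_sign_pattern (hφu : φ u = U) (hφs : φ s = S) {m : G}
    (hm : m ∈ Submonoid.closure {s * u⁻¹, u ^ 3 * s * u}) :
    m = 1 ∨ (1 ≤ φ m 0 0 ∧ 1 ≤ φ m 1 1 ∧ φ m 0 1 ≤ 0 ∧ φ m 1 0 ≤ 0 ∧
      φ m 0 1 + φ m 1 0 < 0) := by
  have hA : ((S * U⁻¹ : SL(2, ℤ)) : Matrix (Fin 2) (Fin 2) ℤ) = !![1, -1; 0, 1] := by decide
  have hB : ((U ^ 3 * S * U : SL(2, ℤ)) : Matrix (Fin 2) (Fin 2) ℤ) = !![1, 0; -1, 1] := by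
    decide
  induction hm using Submonoid.closure_induction_left with
  | one => exact Or.inl rfl
  | mul_left x hx m _ ih =>
    right
    rcases hx with rfl | rfl
    · have h (i j : Fin 2) : φ (s * u⁻¹ * m) i j =
          ((!![1, -1; 0, 1] : Matrix (Fin 2) (Fin 2) ℤ) * (φ m).val) i j := by
        simp only [map_mul, map_inv, hφu, hφs, ← hA]
        rfl
      simp only [h]
      rcases ih with rfl | ih
      · simp
      · simp [Matrix.mul_apply, Fin.sum_univ_two]
        omega
    · have h (i j : Fin 2) : φ (u ^ 3 * s * u * m) i j =
          ((!![1, 0; -1, 1] : Matrix (Fin 2) (Fin 2) ℤ) * (φ m).val) i j := by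
        simp only [map_mul, map_pow, hφu, hφs, ← hB]
        rfl
      simp only [h]
      rcases ih with rfl | ih
      · simp
      · simp [Matrix.mul_apply, Fin.sum_univ_two]
        omega

/-- A group generated by `u`, `s` with `u ^ 6 = 1` and `u ^ 3 = s ^ 2` embeds into `SL(2, ℤ)` by
any homomorphism with `u ↦ U`, `s ↦ S`. -/
theorem injective_of_map_eq (hu : u ^ 6 = 1) (hus : u ^ 3 = s ^ 2)
    (h : Subgroup.closure {u, s} = ⊤) (hφu : φ u = U) (hφs : φ s = S) :
    Function.Injective φ := by
  rw [injective_iff_map_eq_one]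
  intro g hg
  obtain ⟨ζ, c, m, d, hζ, hc, hm, hd, rfl⟩ := isNormalForm_of_closure_eq_top hu hus h g
  have key : φ m = (φ c)⁻¹ * (φ ζ)⁻¹ * (φ d)⁻¹ := by
    simp only [map_mul] at hg
    calc φ m = (φ c)⁻¹ * (φ ζ)⁻¹ * (φ ζ * (φ c * (φ m * φ d))) * (φ d)⁻¹ := by group
      _ = _ := by rw [hg, mul_one]
  have hpos := eq_one_or_sign_pattern hφu hφs hm
  rcases hpos with rfl | hpos
  · rw [map_one] at key
    rcases hζ with rfl | rfl <;> rcases hc with rfl | rfl | rfl <;> rcases hd with rfl | rfl <;>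
      simp only [map_one, map_inv, map_pow, hφu, hφs] at key <;>
      first
      | exact absurd key (by decide)
      | simp
  · exfalso
    rw [key] at hpos
    revert hpos
    rcases hζ with rfl | rfl <;> rcases hc with rfl | rfl | rfl <;> rcases hd with rfl | rfl <;>
      simp only [map_one, map_inv, map_pow, hφu, hφs] <;> decide

end ModularGroup

open ModularGroup in
lemma closure_Ymat : Subgroup.closure {Ymat 1, Ymat 2} = ⊤ := by
  have h1 : Ymat 1 ∈ Subgroup.closure {Ymat 1, Ymat 2} := Subgroup.subset_closure (by simp)
  have h2 : Ymat 2 ∈ Subgroup.closure {Ymat 1, Ymat 2} := Subgroup.subset_closure (by simp)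
  have hT : T ∈ Subgroup.closure {Ymat 1, Ymat 2} := by
    have : T = Ymat 1 * (Ymat 1 * Ymat 2)⁻¹ := by decide
    rw [this]
    exact mul_mem h1 (inv_mem (mul_mem h1 h2))
  have hS : S ∈ Subgroup.closure {Ymat 1, Ymat 2} := by
    have : S = T * (Ymat 1 * Ymat 2) * T⁻¹ := by decide
    rw [this]
    exact mul_mem (mul_mem hT (mul_mem h1 h2)) (inv_mem hT)
  rw [eq_top_iff, ← SpecialLinearGroup.SL2Z_generators, Subgroup.closure_le]
  rintro x (rfl | rfl)
  exacts [hS, hT]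

/-- `SL(2, ℤ)` has the presentation `⟨y₁, y₂ ∣ y₁³ = −1, (y₁y₂)² = −1⟩` with
`y₁ = Y(1)` and `y₂ = Y(2)`: the homomorphism from the free group on two
generators `a, b` sending `a ↦ y₁`, `b ↦ y₂` is surjective, and its kernel is the
normal closure of `{a⁶, a³·((a·b)²)⁻¹}`. -/
theorem SL2Z_presentation :
    Function.Surjective
      (FreeGroup.lift (![Ymat 1, Ymat 2]) :
        FreeGroup (Fin 2) →* Matrix.SpecialLinearGroup (Fin 2) ℤ) ∧
    MonoidHom.ker
        (FreeGroup.lift (![Ymat 1, Ymat 2]) :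
          FreeGroup (Fin 2) →* Matrix.SpecialLinearGroup (Fin 2) ℤ) =
      Subgroup.normalClosure
        ({FreeGroup.of 0 ^ 6,
          FreeGroup.of 0 ^ 3 * ((FreeGroup.of 0 * FreeGroup.of 1) ^ 2)⁻¹} :
          Set (FreeGroup (Fin 2))) := by
  refine ⟨?_, ?_⟩
  · rw [← MonoidHom.range_eq_top, FreeGroup.range_lift_eq_closure]
    simpa [Set.pair_comm] using closure_Ymat
  set f : FreeGroup (Fin 2) →* Matrix.SpecialLinearGroup (Fin 2) ℤ :=
    FreeGroup.lift ![Ymat 1, Ymat 2] with hf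
  let N := Subgroup.normalClosure
        ({FreeGroup.of 0 ^ 6,
          FreeGroup.of 0 ^ 3 * ((FreeGroup.of 0 * FreeGroup.of 1) ^ 2)⁻¹} :
          Set (FreeGroup (Fin 2)))
  have hle : N ≤ f.ker := by
    refine Subgroup.normalClosure_le_normal ?_
    rintro x (rfl | rfl) <;> simp only [SetLike.mem_coe, MonoidHom.mem_ker] <;>
      simp only [hf, map_mul, map_pow, map_inv, FreeGroup.lift_apply_of] <;> decide
  refine le_antisymm (fun x hx => ?_) hle
  let u : FreeGroup (Fin 2) ⧸ N := QuotientGroup.mk' N (FreeGroup.of 0)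
  let s : FreeGroup (Fin 2) ⧸ N := QuotientGroup.mk' N (FreeGroup.of 0 * FreeGroup.of 1)
  let φ := (MulAut.conj ModularGroup.T).toMonoidHom.comp (QuotientGroup.lift N f hle)
  have hφ (y : FreeGroup (Fin 2)) :
      φ (QuotientGroup.mk' N y) = ModularGroup.T * f y * ModularGroup.T⁻¹ := rfl
  have hu : u ^ 6 = 1 := by
    rw [← map_pow]
    exact (QuotientGroup.eq_one_iff _).2 (Subgroup.subset_normalClosure (by simp))
  have hus : u ^ 3 = s ^ 2 := by
    rw [← mul_inv_eq_one, ← map_pow, ← map_pow, ← map_inv, ← map_mul]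
    exact (QuotientGroup.eq_one_iff _).2 (Subgroup.subset_normalClosure (by simp))
  have hgen : Subgroup.closure {u, s} = ⊤ := by
    have hmem_u : u ∈ Subgroup.closure {u, s} := Subgroup.subset_closure (by simp)
    have hmem_s : s ∈ Subgroup.closure {u, s} := Subgroup.subset_closure (by simp)
    rw [eq_top_iff, ← MonoidHom.range_eq_top.2 (QuotientGroup.mk'_surjective N),
      MonoidHom.range_eq_map, ← FreeGroup.closure_range_of, MonoidHom.map_closure,
      Subgroup.closure_le]
    rintro _ ⟨_, ⟨i, rfl⟩, rfl⟩
    fin_cases i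
    · exact hmem_u
    · have h : QuotientGroup.mk' N (FreeGroup.of 1) = u⁻¹ * s := by simp [u, s]
      exact h ▸ mul_mem (inv_mem hmem_u) hmem_s
  have hφu : φ u = ModularGroup.U := by
    rw [hφ, hf, FreeGroup.lift_apply_of]
    decide
  have hφs : φ s = ModularGroup.S := by
    rw [hφ, hf, map_mul, FreeGroup.lift_apply_of, FreeGroup.lift_apply_of]
    decide
  rw [← QuotientGroup.eq_one_iff]
  refine ModularGroup.injective_of_map_eq hu hus hgen hφu hφs ?_
  rw [map_one]
  exact (hφ x).trans (by rw [MonoidHom.mem_ker.1 hx]; group)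
end

section
/- Let K be a field, n ≥ 2 an integer, and let A : ℤ × ℤ → K be a tame SL_2-tiling such that for all i ∈ ℤ: A(i, i) = 1, A(i, i+1) ≠ 0, A(i, i+n−1) = 1, and A(i, i+n) = 0 (so that A is the tame extension of a frieze pattern with n diagonals). Then A has horizontal and vertical skew-period n+1 and diagonal period n+1: for all i, j ∈ ℤ, A(i+n+1, j) = −A(i, j), A(i, j+n+1) = −A(i, j), and consequently A(i+n+1, j+n+1) = A(i, j). -/
theorem IsSL.minor_two {K : Type*} [Field K] {A : ℤ × ℤ → K} (h : IsSL 2 A) (i j : ℤ) :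
    A (i, j) * A (i + 1, j + 1) - A (i, j + 1) * A (i + 1, j) = 1 := by
  simpa [adjMinor, Matrix.det_fin_two] using h i j

/-- In a tame `SL₂`-tiling every row is a combination of any two consecutive rows. -/
theorem IsSL.exists_row_eq {K : Type*} [Field K] {A : ℤ × ℤ → K} (h : IsSL 2 A)
    (hrank : tilingRank K A = 2) (r i : ℤ) :
    ∃ a b : K, ∀ j, A (i, j) = a * A (r, j) + b * A (r + 1, j) := by
  let row : ℤ → ℤ → K := fun i j => A (i, j)
  have hS : Module.finrank K (Submodule.span K (Set.range row)) = 2 :=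
    Module.finrank_eq_of_rank_eq hrank
  have : FiniteDimensional K (Submodule.span K (Set.range row)) :=
    FiniteDimensional.of_finrank_pos (by lia)
  have hli : LinearIndependent K ![row r, row (r + 1)] := by
    rw [LinearIndependent.pair_iff]
    intro s t hst
    have h0 := congrFun hst 0
    have h1 := congrFun hst 1
    have hm := h.minor_two r 0
    simp only [row, Pi.add_apply, Pi.smul_apply, smul_eq_mul, Pi.zero_apply, zero_add] at h0 h1 hm
    constructor
    · linear_combination A (r + 1, 1) * h0 - A (r + 1, 0) * h1 - s * hm
    · linear_combination A (r, 0) * h1 - A (r, 1) * h0 - t * hm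
  have hspan : Submodule.span K (Set.range ![row r, row (r + 1)]) =
      Submodule.span K (Set.range row) := by
    refine Submodule.eq_of_le_of_finrank_eq (Submodule.span_mono ?_) ?_
    · rintro _ ⟨k, rfl⟩
      fin_cases k
      · exact ⟨r, rfl⟩
      · exact ⟨r + 1, rfl⟩
    · rw [hS, finrank_span_eq_card hli, Fintype.card_fin]
  have hi : row i ∈ Submodule.span K (Set.range row) := Submodule.subset_span ⟨i, rfl⟩
  rw [← hspan, Matrix.range_cons, Matrix.range_cons, Matrix.range_empty, Set.union_empty,
    Set.singleton_union, Submodule.mem_span_pair] at hi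
  obtain ⟨a, b, hab⟩ := hi
  exact ⟨a, b, fun j => (congrFun hab j).symm⟩

/-- The tame `SL₂`-tiling extending a frieze pattern with `n` diagonals has
horizontal and vertical skew-period `n+1`, and hence diagonal period `n+1`. -/
theorem frieze_skew_periodicity {K : Type*} [Field K] (n : ℕ) (hn : 2 ≤ n)
    (A : ℤ × ℤ → K) (hSL : IsSL 2 A) (htame : tilingRank K A = 2)
    (hdiag : ∀ i : ℤ, A (i, i) = 1)
    (hnonzero : ∀ i : ℤ, A (i, i + 1) ≠ 0)
    (hborder : ∀ i : ℤ, A (i, i + (n : ℤ) - 1) = 1)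
    (hzero : ∀ i : ℤ, A (i, i + (n : ℤ)) = 0) :
    ∀ i j : ℤ,
      A (i + (n : ℤ) + 1, j) = -A (i, j) ∧
      A (i, j + (n : ℤ) + 1) = -A (i, j) ∧
      A (i + (n : ℤ) + 1, j + (n : ℤ) + 1) = A (i, j) := by
  have hbelow (i : ℤ) : A (i + 1, i) = 0 := by
    have hm := hSL.minor_two i i
    rw [hdiag, hdiag] at hm
    exact (mul_eq_zero.mp (by linear_combination -hm)).resolve_left (hnonzero i)
  have hrow (i j : ℤ) : A (i + n + 1, j) = -A (i, j) := by
    obtain ⟨a, b, hab⟩ := hSL.exists_row_eq htame i (i + n + 1)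
    have hb : b = 0 := by
      have h1 := hab (i + n)
      have h2 := hborder (i + 1)
      rw [show i + 1 + (n : ℤ) - 1 = i + n by ring] at h2
      rw [hbelow, hzero, h2] at h1
      linear_combination -h1
    have ha : a = -1 := by
      have h1 := hab (i + n - 1)
      have hm := hSL.minor_two (i + n) (i + n - 1)
      rw [sub_add_cancel, hdiag, hbelow] at hm
      rw [hborder, hb] at h1
      linear_combination -h1 - hm
    rw [hab, ha, hb]
    ring
  have hcol (i j : ℤ) : A (i, j + n + 1) = -A (i, j) := by
    obtain ⟨a, b, hab⟩ := hSL.exists_row_eq htame j i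
    have hm := hSL.minor_two j (j + n)
    have h2 := hborder (j + 1)
    have h3 := hzero (j + 1)
    rw [show j + 1 + (n : ℤ) - 1 = j + n by ring] at h2
    rw [show j + 1 + (n : ℤ) = j + n + 1 by ring] at h3
    rw [h2, h3] at hm
    rw [hab, hab j, h3, hbelow, hdiag]
    linear_combination -a * hm
  exact fun i j => ⟨hrow i j, hcol i j, by rw [hrow, hcol, neg_neg]⟩
end

section
/- Let K be a field, n ≥ 2 an integer, and let A : ℤ × ℤ → K be a tame SL_2-tiling such that for all i ∈ ℤ: A(i, i) = 1, A(i, i+1) ≠ 0, A(i, i+n−1) = 1, and A(i, i+n) = 0 (the tame extension of a frieze pattern with n diagonals). Then A is invariant under the glide symmetry obtained by reflecting in the middle diagonal of the frieze band and translating by (n+1)/2 along the diagonal: for all i, j ∈ ℤ, A(i, j) = A(j+1, i+n). -/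
/-- An `SL₂`-tiling satisfies the unimodular rule. -/
theorem IsSL.two_rule {K : Type*} [Field K] {A : ℤ × ℤ → K} (hSL : IsSL 2 A) (i j : ℤ) :
    A (i, j) * A (i + 1, j + 1) - A (i, j + 1) * A (i + 1, j) = 1 := by
  simpa [adjMinor, Matrix.det_fin_two] using hSL i j

/-- In a tiling of rank at most `2`, three rows satisfy a nontrivial linear relation. -/
theorem exists_row_relation_of_tilingRank_le_two {K : Type*} [Field K] {A : ℤ × ℤ → K}
    (h : tilingRank K A ≤ 2) (r : Fin 3 → ℤ) :
    ∃ g : Fin 3 → K, (∀ j, g 0 * A (r 0, j) + g 1 * A (r 1, j) + g 2 * A (r 2, j) = 0) ∧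
      ∃ s, g s ≠ 0 := by
  let v : Fin 3 → Submodule.span K (Set.range fun i : ℤ => fun j : ℤ => A (i, j)) :=
    fun s => ⟨fun j => A (r s, j), Submodule.subset_span ⟨r s, rfl⟩⟩
  have hv : ¬ LinearIndependent K v := by
    intro hli
    have hle := hli.cardinal_lift_le_rank.trans (Cardinal.lift_le.mpr h)
    rw [Cardinal.mk_fin, Cardinal.lift_natCast, Cardinal.lift_ofNat] at hle
    exact absurd (show 3 ≤ 2 by exact_mod_cast hle) (by norm_num)
  obtain ⟨g, hg, hne⟩ := Fintype.not_linearIndependent_iff.mp hv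
  refine ⟨g, fun j => ?_, hne⟩
  have hj := congrFun (congrArg Subtype.val hg) j
  simpa [Fin.sum_univ_three, v] using hj

/-- In a tame `SL₂`-tiling, the `2 × 2` minors of two adjacent rows do not depend on the rows:
passing to the next pair of rows does not change them. -/
theorem IsSL.minor_succ_row {K : Type*} [Field K] {A : ℤ × ℤ → K} (hSL : IsSL 2 A)
    (h : tilingRank K A ≤ 2) (i j k : ℤ) :
    A (i + 1, j) * A (i + 1 + 1, k) - A (i + 1, k) * A (i + 1 + 1, j) =
      A (i, j) * A (i + 1, k) - A (i, k) * A (i + 1, j) := by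
  obtain ⟨g, hg, s, hs⟩ := exists_row_relation_of_tilingRank_le_two h ![i, i + 1, i + 1 + 1]
  simp only [Matrix.cons_val] at hg
  have h0 := hSL.two_rule i 0
  have h1 := hSL.two_rule (i + 1) 0
  have e0 := hg 0
  have e1 := hg (0 + 1)
  have h02 : g 0 = g 2 := by
    linear_combination (-g 0) * h0 + g 2 * h1 + A (i + 1, 0 + 1) * e0 - A (i + 1, 0) * e1
  have h2 : g 2 ≠ 0 := by
    intro hz
    have h0z : g 0 = 0 := h02.trans hz
    have h1z : g 1 = 0 := by
      rw [hz, h0z] at e0 e1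
      linear_combination (-g 1) * h0 + A (i, 0) * e1 - A (i, 0 + 1) * e0
    fin_cases s <;> simp_all
  apply mul_left_cancel₀ h2
  have ej := hg j
  have ek := hg k
  rw [h02] at ej ek
  linear_combination A (i + 1, j) * ek - A (i + 1, k) * ej

/-- In a tame `SL₂`-tiling, all pairs of adjacent rows have the same `2 × 2` minors. -/
theorem IsSL.minor_row_eq {K : Type*} [Field K] {A : ℤ × ℤ → K} (hSL : IsSL 2 A)
    (h : tilingRank K A ≤ 2) (i i' j k : ℤ) :
    A (i, j) * A (i + 1, k) - A (i, k) * A (i + 1, j) =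
      A (i', j) * A (i' + 1, k) - A (i', k) * A (i' + 1, j) := by
  induction i using Int.inductionOn' (b := i') with
  | zero => rfl
  | succ m _ ih => rw [hSL.minor_succ_row h, ih]
  | pred m _ ih =>
    have hm := hSL.minor_succ_row h (m - 1) j k
    rw [sub_add_cancel] at hm
    rw [sub_add_cancel, ← hm, ih]

/-- The tame `SL₂`-tiling extending a frieze pattern with `n` diagonals is invariant
under the glide symmetry: `A (i, j) = A (j + 1, i + n)`. -/
theorem frieze_glide_symmetry {K : Type*} [Field K] (n : ℕ) (hn : 2 ≤ n)
    (A : ℤ × ℤ → K) (hSL : IsSL 2 A) (htame : tilingRank K A = 2)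
    (hdiag : ∀ i : ℤ, A (i, i) = 1)
    (hnonzero : ∀ i : ℤ, A (i, i + 1) ≠ 0)
    (hborder : ∀ i : ℤ, A (i, i + (n : ℤ) - 1) = 1)
    (hzero : ∀ i : ℤ, A (i, i + (n : ℤ)) = 0) :
    ∀ i j : ℤ, A (i, j) = A (j + 1, i + (n : ℤ)) := by
  intro i j
  have hsub : A (j + 1, j) = 0 := by
    have hj := hSL.two_rule j j
    rw [hdiag, hdiag] at hj
    refine (mul_eq_zero.mp ?_).resolve_left (hnonzero j)
    linear_combination -hj
  have hone : A (i + 1, i + (n : ℤ)) = 1 := by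
    have hi := hborder (i + 1)
    rwa [show i + 1 + (n : ℤ) - 1 = i + n by ring] at hi
  have hminor := hSL.minor_row_eq htame.le j i j (i + n)
  rw [hdiag, hsub, hzero, hone] at hminor
  linear_combination -hminor
end

section
/- Fix an integer k ≥ 1 and define A : ℕ × ℕ → ℤ by A(i, j) = Σ_{l=0}^{k−1} (i choose l)·(j choose l). Then: (1) for all i, j ∈ ℕ, the adjacent k×k minor det (A(i+s, j+t))_{0≤s,t<k} equals 1, so A is a quarter-plane SL_k-array; and (2) for every m with 1 ≤ m < k and all i, j ∈ ℕ, the minors along the first row and first column are also 1: det (A(i+s, t))_{0≤s,t<m} = 1 and det (A(s, j+t))_{0≤s,t<m} = 1. -/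
open Finset Matrix in
/-- The `m × m` matrix of binomial coefficients `(i + s choose l)` is unimodular. -/
theorem det_of_choose_add (m i : ℕ) :
    (of fun s l : Fin m => ((i + (s : ℕ)).choose l : ℤ)).det = 1 := by
  have h_mul : (of fun s l : Fin m => ((i + (s : ℕ)).choose l : ℤ)) =
      (of fun s p : Fin m => ((s : ℕ).choose p : ℤ)) *
        of fun p l : Fin m => if (p : ℕ) ≤ l then (i.choose (l - p) : ℤ) else 0 := by
    ext s l
    simp only [mul_apply, of_apply]
    rw [Fin.sum_univ_eq_sum_range
      (fun p => ((s : ℕ).choose p : ℤ) * if p ≤ (l : ℕ) then (i.choose (l - p) : ℤ) else 0) m,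
      add_comm, Nat.add_choose_eq, Nat.sum_antidiagonal_eq_sum_range_succ_mk]
    push_cast
    rw [← sum_subset (range_subset_range.2 (Nat.succ_le_of_lt l.isLt))]
    · refine sum_congr rfl fun p hp => ?_
      rw [if_pos (Nat.le_of_lt_succ (mem_range.1 hp))]
    · intro p _ hp
      rw [if_neg fun h => hp (mem_range.2 (Nat.lt_succ_of_le h)), mul_zero]
  rw [h_mul, det_mul, det_of_isLowerTriangular, det_of_isUpperTriangular]
  · simp
  · intro p l h
    exact if_neg (not_le.2 h)
  · intro s p h
    exact Nat.cast_eq_zero.2 (Nat.choose_eq_zero_of_lt h)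

open Finset Matrix in
theorem det_of_sum_choose_mul_choose (m i j : ℕ) :
    (of fun s t : Fin m => ∑ l ∈ range m,
      ((i + (s : ℕ)).choose l : ℤ) * ((j + (t : ℕ)).choose l : ℤ)).det = 1 := by
  have h_mul : (of fun s t : Fin m => ∑ l ∈ range m,
      ((i + (s : ℕ)).choose l : ℤ) * ((j + (t : ℕ)).choose l : ℤ)) =
      (of fun s l : Fin m => ((i + (s : ℕ)).choose l : ℤ)) *
        (of fun t l : Fin m => ((j + (t : ℕ)).choose l : ℤ))ᵀ := by
    ext s t
    simp only [mul_apply, of_apply, transpose_apply]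
    exact (Fin.sum_univ_eq_sum_range
      (fun l => ((i + (s : ℕ)).choose l : ℤ) * ((j + (t : ℕ)).choose l : ℤ)) m).symm
  rw [h_mul, det_mul, det_transpose, det_of_choose_add, det_of_choose_add, one_mul]


/-- The quarter-plane array `A (i, j) = Σ_{l=0}^{k−1} (i choose l)·(j choose l)` is an
`SL_k`-array: all adjacent `k × k` minors equal `1`, and moreover all the adjacent
`m × m` minors along the first row and first column, `1 ≤ m < k`, also equal `1`. -/
theorem binomial_quarter_plane_SLk (k : ℕ) (hk : 1 ≤ k) (A : ℕ × ℕ → ℤ)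
    (hA : ∀ i j : ℕ, A (i, j) =
      ∑ l ∈ Finset.range k, (Nat.choose i l : ℤ) * (Nat.choose j l : ℤ)) :
    (∀ i j : ℕ,
      (Matrix.of fun s t : Fin k => A (i + (s : ℕ), j + (t : ℕ))).det = 1) ∧
    (∀ m : ℕ, 1 ≤ m → m < k → ∀ i j : ℕ,
      (Matrix.of fun s t : Fin m => A (i + (s : ℕ), (t : ℕ))).det = 1 ∧
      (Matrix.of fun s t : Fin m => A ((s : ℕ), j + (t : ℕ))).det = 1) := by
  have h_symm : ∀ i j, A (i, j) = A (j, i) := fun i j => by simp only [hA, mul_comm]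
  have h_row : ∀ m, m < k → ∀ i : ℕ,
      (Matrix.of fun s t : Fin m => A (i + (s : ℕ), (t : ℕ))).det = 1 := by
    intro m hm i
    rw [← det_of_sum_choose_mul_choose m i 0]
    congr 1
    ext s t
    simp only [Matrix.of_apply, hA, zero_add]
    refine (Finset.sum_subset (Finset.range_subset_range.2 hm.le) fun l _ hl => ?_).symm
    have htl : (t : ℕ) < l := t.isLt.trans_le (not_lt.1 fun h => hl (Finset.mem_range.2 h))
    rw [Nat.choose_eq_zero_of_lt htl, Nat.cast_zero, mul_zero]
  refine ⟨fun i j => ?_, fun m _ hm i j => ⟨h_row m hm i, ?_⟩⟩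
  · simp only [hA]
    exact det_of_sum_choose_mul_choose k i j
  · rw [← Matrix.det_transpose, ← h_row m hm j]
    congr 1
    ext s t
    exact h_symm _ _
end

section
/- For every n ≥ 1 and for h ∈ {0, 1}, the n×n Hankel matrix of Catalan numbers (C_{h+i+j})_{0≤i,j<n} has determinant 1 over ℤ, where C_m denotes the m-th Catalan number. -/
/-- The ballot number counting nonnegative `±1` lattice paths of length `2 * i + h` from height `0`
to height `2 * k + h`, by the reflection principle. -/
def ballotNumber (h i k : ℕ) : ℤ :=
  (2 * i + h).choose (i + k + h) - (2 * i + h).choose (i + k + h + 1)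

theorem ballotNumber_eq_zero_of_lt (h : ℕ) {i k : ℕ} (hik : i < k) : ballotNumber h i k = 0 := by
  unfold ballotNumber
  rw [Nat.choose_eq_zero_of_lt (by lia), Nat.choose_eq_zero_of_lt (by lia), sub_self]

theorem ballotNumber_self (h i : ℕ) : ballotNumber h i i = 1 := by
  unfold ballotNumber
  rw [← two_mul, Nat.choose_self, Nat.choose_succ_self]
  simp

theorem choose_add_two_add_two (m r : ℕ) :
    (m + 2).choose (r + 2) = m.choose r + 2 * m.choose (r + 1) + m.choose (r + 2) := by
  simp only [Nat.choose_succ_succ' (m + 1), Nat.choose_succ_succ' m]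
  ring

theorem ballotNumber_succ_succ (h i k : ℕ) :
    ballotNumber h (i + 1) (k + 1) =
      ballotNumber h i k + 2 * ballotNumber h i (k + 1) + ballotNumber h i (k + 2) := by
  unfold ballotNumber
  rw [show 2 * (i + 1) + h = 2 * i + h + 2 by ring,
    show i + 1 + (k + 1) + h = i + k + h + 2 by ring,
    show i + (k + 1) + h = i + k + h + 1 by ring,
    show i + (k + 2) + h = i + k + h + 2 by ring,
    choose_add_two_add_two, choose_add_two_add_two _ (i + k + h + 1)]
  push_cast
  ring

theorem ballotNumber_zero_succ_zero (i : ℕ) :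
    ballotNumber 0 (i + 1) 0 = ballotNumber 0 i 0 + ballotNumber 0 i 1 := by
  unfold ballotNumber
  cases i with
  | zero => decide
  | succ i =>
    have hsymm : (2 * (i + 1)).choose i = (2 * (i + 1)).choose (i + 2) :=
      Nat.choose_symm_of_eq_add (by ring)
    simp only [add_zero]
    rw [show 2 * (i + 1 + 1) = 2 * (i + 1) + 2 by ring,
      choose_add_two_add_two _ i, choose_add_two_add_two _ (i + 1), hsymm]
    push_cast
    ring

theorem ballotNumber_one_succ_zero (i : ℕ) :
    ballotNumber 1 (i + 1) 0 = 2 * ballotNumber 1 i 0 + ballotNumber 1 i 1 := by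
  unfold ballotNumber
  have hsymm : (2 * i + 1).choose i = (2 * i + 1).choose (i + 1) :=
    Nat.choose_symm_of_eq_add (by ring)
  simp only [add_zero]
  rw [show 2 * (i + 1) + 1 = 2 * i + 1 + 2 by ring,
    choose_add_two_add_two _ i, choose_add_two_add_two _ (i + 1), hsymm]
  push_cast
  ring

theorem ballotNumber_zero_zero (i : ℕ) : ballotNumber 0 i 0 = catalan i := by
  have hcat : ((i : ℤ) + 1) * catalan i = (2 * i).choose i := by
    exact_mod_cast succ_mul_catalan_eq_centralBinom i
  have hchoose : ((2 * i).choose (i + 1) : ℤ) * (i + 1) = (2 * i).choose i * i := by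
    have := Nat.choose_succ_right_eq (2 * i) i
    rw [show 2 * i - i = i by lia] at this
    exact_mod_cast this
  apply mul_left_cancel₀ (show (i : ℤ) + 1 ≠ 0 by positivity)
  simp only [ballotNumber, add_zero]
  linear_combination -hcat - hchoose

theorem ballotNumber_one_zero (i : ℕ) : ballotNumber 1 i 0 = catalan (i + 1) := by
  have hsymm : (2 * i + 1).choose i = (2 * i + 1).choose (i + 1) :=
    Nat.choose_symm_of_eq_add (by ring)
  rw [← ballotNumber_zero_zero]
  simp only [ballotNumber, add_zero]
  rw [show 2 * (i + 1) = 2 * i + 1 + 1 by ring, Nat.choose_succ_succ' (2 * i + 1) i,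
    Nat.choose_succ_succ' (2 * i + 1) (i + 1), hsymm]
  push_cast
  ring

theorem ballotNumber_zero_right {h : ℕ} (hh : h = 0 ∨ h = 1) (i : ℕ) :
    ballotNumber h i 0 = catalan (h + i) := by
  rcases hh with rfl | rfl
  · rw [ballotNumber_zero_zero, zero_add]
  · rw [ballotNumber_one_zero, add_comm]

theorem sum_ballotNumber_succ_mul_sub {h : ℕ} (hh : h = 0 ∨ h = 1) (i j N : ℕ) :
    ∑ k ∈ Finset.range (N + 1), (ballotNumber h (i + 1) k * ballotNumber h j k -
        ballotNumber h i k * ballotNumber h (j + 1) k) =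
      ballotNumber h i (N + 1) * ballotNumber h j N -
        ballotNumber h i N * ballotNumber h j (N + 1) := by
  induction N with
  | zero =>
    rcases hh with rfl | rfl
    · simp only [zero_add, Finset.sum_range_one, ballotNumber_zero_succ_zero]
      ring
    · simp only [zero_add, Finset.sum_range_one, ballotNumber_one_succ_zero]
      ring
  | succ N ih =>
    rw [Finset.sum_range_succ, ih, ballotNumber_succ_succ, ballotNumber_succ_succ]
    ring

theorem sum_ballotNumber_mul {h : ℕ} (hh : h = 0 ∨ h = 1) {i j N : ℕ} (hN : i + j ≤ N) :
    ∑ k ∈ Finset.range (N + 1), ballotNumber h i k * ballotNumber h j k =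
      ballotNumber h (i + j) 0 := by
  induction i generalizing j with
  | zero =>
    rw [Finset.sum_range_succ', Finset.sum_eq_zero, ballotNumber_self, zero_add, zero_add, one_mul]
    intro k _
    rw [ballotNumber_eq_zero_of_lt h k.succ_pos, zero_mul]
  | succ i ih =>
    have hsub := sum_ballotNumber_succ_mul_sub hh i j N
    rw [Finset.sum_sub_distrib, ih (by lia), ballotNumber_eq_zero_of_lt h (show i < N + 1 by lia),
      ballotNumber_eq_zero_of_lt h (show j < N + 1 by lia)] at hsub
    rw [show i + 1 + j = i + (j + 1) by ring]
    linear_combination hsub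

/-- The lower unitriangular matrix of ballot numbers. -/
def ballotMatrix (h n : ℕ) : Matrix (Fin n) (Fin n) ℤ :=
  Matrix.of fun i k => ballotNumber h i k

theorem det_ballotMatrix (h n : ℕ) : (ballotMatrix h n).det = 1 := by
  rw [Matrix.det_of_isLowerTriangular]
  · exact Finset.prod_eq_one fun i _ => ballotNumber_self h i
  · intro i k hik
    exact ballotNumber_eq_zero_of_lt h hik

theorem ballotMatrix_mul_transpose {h : ℕ} (hh : h = 0 ∨ h = 1) (n : ℕ) :
    ballotMatrix h n * (ballotMatrix h n).transpose =
      Matrix.of fun i j : Fin n => (catalan (h + (i : ℕ) + (j : ℕ)) : ℤ) := by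
  ext i j
  rw [Matrix.mul_apply, Matrix.of_apply, add_assoc, ← ballotNumber_zero_right hh,
    ← sum_ballotNumber_mul hh (show (i : ℕ) + j ≤ n + n by lia)]
  simp only [ballotMatrix, Matrix.transpose_apply, Matrix.of_apply]
  rw [Fin.sum_univ_eq_sum_range (fun k => ballotNumber h i k * ballotNumber h j k)]
  refine Finset.sum_subset (Finset.range_subset_range.2 (by lia)) fun k _ hk => ?_
  rw [Finset.mem_range, not_lt] at hk
  rw [ballotNumber_eq_zero_of_lt h (i.isLt.trans_le hk), zero_mul]

/-- For every `n ≥ 1` and `h ∈ {0, 1}`, the `n × n` Hankel matrix of Catalan numbers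
`(C_{h+i+j})_{0 ≤ i,j < n}` has determinant `1`. -/
theorem catalan_hankel_det (n : ℕ) (hn : 1 ≤ n) (h : ℕ) (hh : h = 0 ∨ h = 1) :
    (Matrix.of fun i j : Fin n =>
      (catalan (h + (i : ℕ) + (j : ℕ)) : ℤ)).det = 1 := by
  rw [← ballotMatrix_mul_transpose hh, Matrix.det_mul, Matrix.det_transpose,
    det_ballotMatrix, one_mul]
end

section
/- Let K be a field and k ≥ 1. Let N be the k×k nilpotent shift matrix over K with N(s, t) = 1 if t = s+1 and 0 otherwise, and set μ(x) = Id + N and μ(y) = Id + Nᵀ. Given natural numbers m₁, …, m_{k−1}, define for 0 ≤ i ≤ k−1 the matrix U_i := μ(x)^{m_{i−1}}·μ(y)·μ(x)^{m_{i−2}}·μ(y)···μ(x)^{m₁}·μ(y) (so U_0 = Id and U_i = (Id+N)^{m_{i−1}}(Id+Nᵀ)···(Id+N)^{m₁}(Id+Nᵀ)). Let v_i be the last row of U_i (row index k−1). Then for each 0 ≤ i ≤ k−1, v_i(j) = 0 for all j < k−1−i and v_i(k−1−i) = 1; in particular the k×k matrix whose i-th row is v_i is anti-unitriangular, with 1's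 on the antidiagonal and zeros above it. -/
/-- `A` vanishes below its `d`-th subdiagonal, on which all its entries are `1`. -/
def Matrix.IsUnitLowerBand {R : Type*} [Zero R] [One R] {k : ℕ} (d : ℕ)
    (A : Matrix (Fin k) (Fin k) R) : Prop :=
  ∀ s t : Fin k, ((t : ℕ) + d < s → A s t = 0) ∧ ((t : ℕ) + d = s → A s t = 1)

namespace Matrix.IsUnitLowerBand

variable {R : Type*} [Semiring R] {k : ℕ}

theorem one : IsUnitLowerBand 0 (1 : Matrix (Fin k) (Fin k) R) := by
  refine fun s t => ⟨fun h => Matrix.one_apply_ne ?_, fun h => ?_⟩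
  · rintro rfl
    omega
  · obtain rfl : t = s := Fin.ext h
    exact Matrix.one_apply_eq t

theorem mul {d e : ℕ} {A B : Matrix (Fin k) (Fin k) R}
    (hA : IsUnitLowerBand d A) (hB : IsUnitLowerBand e B) :
    IsUnitLowerBand (d + e) (A * B) := by
  refine fun s j => ⟨fun h => ?_, fun h => ?_⟩
  · rw [Matrix.mul_apply]
    refine Finset.sum_eq_zero fun t _ => ?_
    by_cases ht : (t : ℕ) + d < s
    · rw [(hA s t).1 ht, zero_mul]
    · rw [(hB t j).1 (by omega), mul_zero]
  · have hs := s.isLt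
    rw [Matrix.mul_apply, Finset.sum_eq_single (⟨j + e, by omega⟩ : Fin k)]
    · rw [(hA s _).2 (by simp only; omega), (hB _ j).2 rfl, mul_one]
    · intro t _ hne
      have hne' : (t : ℕ) ≠ j + e := fun h' => hne (Fin.ext h')
      by_cases ht : (t : ℕ) + d < s
      · rw [(hA s t).1 ht, zero_mul]
      · rw [(hB t j).1 (by omega), mul_zero]
    · exact fun h' => absurd (Finset.mem_univ _) h'

theorem pow {A : Matrix (Fin k) (Fin k) R} (hA : IsUnitLowerBand 0 A) (n : ℕ) :
    IsUnitLowerBand 0 (A ^ n) := by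
  induction n with
  | zero => simpa using one
  | succ n ih => simpa only [pow_succ] using ih.mul hA

end Matrix.IsUnitLowerBand


/-- Let `N` be the `k × k` nilpotent shift matrix and `μ(x) = Id + N`,
`μ(y) = Id + N.transpose`.  For natural numbers `m₁, m₂, …` let
`U_i = μ(x)^{m_i}·μ(y)·μ(x)^{m_{i-1}}·μ(y)⋯μ(x)^{m₁}·μ(y)` (with `U_0 = Id`).
Then for `0 ≤ i ≤ k − 1`, the bottom row `v_i` of `U_i` satisfies `v_i (j) = 0`
for `j < k − 1 − i` and `v_i (k − 1 − i) = 1`; in particular the matrix with rows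
`v_0, …, v_{k-1}` is anti-unitriangular. -/
theorem bottom_rows_antiunitriangular {K : Type*} [Field K] (k : ℕ) (hk : 1 ≤ k)
    (N : Matrix (Fin k) (Fin k) K)
    (hN : ∀ s t : Fin k, N s t = if (t : ℕ) = (s : ℕ) + 1 then 1 else 0)
    (m : ℕ → ℕ)
    (U : ℕ → Matrix (Fin k) (Fin k) K)
    (hU0 : U 0 = 1)
    (hUsucc : ∀ i : ℕ, U (i + 1) = (1 + N) ^ (m (i + 1)) * (1 + N.transpose) * U i) :
    ∀ i : ℕ, i ≤ k - 1 →
      (∀ j : Fin k, (j : ℕ) < k - 1 - i → U i ⟨k - 1, by omega⟩ j = 0) ∧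
      U i ⟨k - 1, by omega⟩ ⟨k - 1 - i, by omega⟩ = 1 := by
  have hx : (1 + N).IsUnitLowerBand 0 := by
    intro s t
    simp only [Matrix.add_apply, Matrix.one_apply, hN, Fin.ext_iff]
    constructor <;> intro h
    · rw [if_neg (by omega), if_neg (by omega), add_zero]
    · rw [if_pos (by omega), if_neg (by omega), add_zero]
  have hy : (1 + N.transpose).IsUnitLowerBand 1 := by
    intro s t
    simp only [Matrix.add_apply, Matrix.one_apply, Matrix.transpose_apply, hN, Fin.ext_iff]
    constructor <;> intro h
    · rw [if_neg (by omega), if_neg (by omega), add_zero]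
    · rw [if_neg (by omega), if_pos (by omega), zero_add]
  have hU : ∀ i, (U i).IsUnitLowerBand i := by
    intro i
    induction i with
    | zero => exact hU0 ▸ Matrix.IsUnitLowerBand.one
    | succ i ih =>
      rw [hUsucc]
      simpa only [zero_add, add_comm 1 i] using ((hx.pow (m (i + 1))).mul hy).mul ih
  intro i hi
  exact ⟨fun j hj => (hU i _ j).1 (by simp only; omega), (hU i _ _).2 (by simp only; omega)⟩
end
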